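/- Let n ≥ 2 and 2 ≤ p < ∞. For every f ∈ C_0^∞(ℝ^n), the estimate ‖ r^{(n-1)(1/2 - 1/p)} f ‖_{L^p_r L^2_ω} ≲ ‖f‖_{Ḣ^{1/2 - 1/p}} holds, where the L^p_r norm is taken with respect to the measure r^{n-1} dr on (0,∞). -/

import Mathlib

open MeasureTheory Metric Set ENNReal NNReal FourierTransform

noncomputable section

/-- Euclidean space ℝⁿ. -/
abbrev Euc (n : ℕ) := EuclideanSpace ℝ (Fin n)

/-- Surface measure on the unit sphere of ℝⁿ. -/
def sphMeas (n : ℕ) : Measure (sphere (0 : Euc n) 1) :=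
  (volume : Measure (Euc n)).toSphere

/-- `L²` norm (valued in ℝ≥0∞) of a function on the unit sphere of ℝⁿ. -/
def L2sph {n : ℕ} (g : sphere (0 : Euc n) 1 → ℂ) : ℝ≥0∞ :=
  (∫⁻ ω, (‖g ω‖₊ : ℝ≥0∞) ^ (2 : ℝ) ∂(sphMeas n)) ^ (1/2 : ℝ)

/-- Sobolev–Slobodeckij norm `H^σ` (valued in ℝ≥0∞) on the unit sphere of ℝⁿ,
defined via the Gagliardo seminorm; for `σ = 0` it is the `L²` norm. -/
def HsphNorm {n : ℕ} (σ : ℝ) (g : sphere (0 : Euc n) 1 → ℂ) : ℝ≥0∞ :=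
  L2sph g + (if σ = 0 then 0 else
    (∫⁻ ω, ∫⁻ ω', (‖g ω - g ω'‖₊ : ℝ≥0∞) ^ (2:ℝ) /
        ENNReal.ofReal (dist ω ω' ^ ((n : ℝ) - 1 + 2 * σ)) ∂(sphMeas n) ∂(sphMeas n))
      ^ (1/2 : ℝ))

/-- Homogeneous Sobolev norm `Ḣ^s` (valued in ℝ≥0∞), defined on the Fourier side. -/
def homSobNorm {n : ℕ} (s : ℝ) (f : Euc n → ℂ) : ℝ≥0∞ :=
  (∫⁻ ξ : Euc n, ENNReal.ofReal (‖ξ‖ ^ (2 * s)) * (‖𝓕 f ξ‖₊ : ℝ≥0∞) ^ (2:ℝ)) ^ (1/2 : ℝ)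

/-- Weighted `L²` norm `‖ |x|^β g ‖_{L²}` (valued in ℝ≥0∞). -/
def wL2 {n : ℕ} (β : ℝ) (g : Euc n → ℝ≥0∞) : ℝ≥0∞ :=
  (∫⁻ x : Euc n, (ENNReal.ofReal (‖x‖ ^ β) * g x) ^ (2:ℝ)) ^ (1/2 : ℝ)


lemma lintegral_polar {n : ℕ} (hn : 2 ≤ n) (h : Euc n → ℝ≥0∞) (hm : Measurable h) :
    ∫⁻ x, h x = ∫⁻ r in Ioi (0:ℝ), ENNReal.ofReal (r ^ ((n:ℝ) - 1)) *
      ∫⁻ ω, h (r • ω.val) ∂(sphMeas n) := by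
  have hmp := (volume : Measure (Euc n)).measurePreserving_homeomorphUnitSphereProd
  have hfr : Module.finrank ℝ (Euc n) = n := by simp
  have : Nontrivial (Euc n) := by
    apply Module.nontrivial_of_finrank_pos (R := ℝ)
    omega
  have h1 : ∫⁻ x, h x = ∫⁻ x : ({(0 : Euc n)}ᶜ : Set (Euc n)), h x.1 ∂(volume.comap Subtype.val) := by
    rw [lintegral_subtype_comap (measurableSet_singleton _).compl, restrict_compl_singleton]
  have h2 : ∫⁻ x : ({(0 : Euc n)}ᶜ : Set (Euc n)), h x.1 ∂(volume.comap Subtype.val) =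
      ∫⁻ z : sphere (0 : Euc n) 1 × Ioi (0:ℝ), h (z.2.1 • z.1.1)
        ∂((volume : Measure (Euc n)).toSphere.prod (Measure.volumeIoiPow (Module.finrank ℝ (Euc n) - 1))) := by
    rw [← hmp.lintegral_comp (by fun_prop)]
    refine lintegral_congr fun x => ?_
    congr 1
    simp only [homeomorphUnitSphereProd_apply_fst_coe, homeomorphUnitSphereProd_apply_snd_coe]
    rw [smul_inv_smul₀]
    exact norm_ne_zero_iff.2 x.2
  rw [h1, h2, lintegral_prod_symm' _ (by fun_prop), hfr, Measure.volumeIoiPow,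
    lintegral_withDensity_eq_lintegral_mul₀ (by fun_prop)]
  · rw [← lintegral_subtype_comap measurableSet_Ioi]
    refine lintegral_congr fun r => ?_
    simp only [Pi.mul_apply, sphMeas]
    congr 2
    rw [← Real.rpow_natCast]
    congr 1
    push_cast [Nat.cast_sub (show 1 ≤ n by omega)]
    rfl
  · apply Measurable.aemeasurable
    apply Measurable.lintegral_prod_left' (f := fun z : sphere (0 : Euc n) 1 × Ioi (0:ℝ) => h (z.2.1 • z.1.1))
    fun_prop

lemma schur_test {α : Type*} [MeasurableSpace α] (μ : Measure α) [SFinite μ]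
    (K : α → α → ℝ≥0∞) (hK : Measurable (fun z : α × α => K z.1 z.2)) (M : ℝ≥0∞)
    (h1 : ∀ x, ∫⁻ y, K x y ∂μ ≤ M) (h2 : ∀ y, ∫⁻ x, K x y ∂μ ≤ M)
    (u v : α → ℝ≥0∞) (hu : Measurable u) (hv : Measurable v) :
    ∫⁻ x, ∫⁻ y, u x * v y * K x y ∂μ ∂μ ≤
      M * ((∫⁻ x, u x ^ (2:ℝ) ∂μ) ^ (1/2:ℝ) * (∫⁻ x, v x ^ (2:ℝ) ∂μ) ^ (1/2:ℝ)) := by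
  have hK1 : ∀ x, Measurable (K x) := fun x => hK.comp measurable_prodMk_left
  have hK2 : ∀ y, Measurable (fun x => K x y) := fun y => hK.comp (measurable_prodMk_right)
  have e0 : ∫⁻ x, ∫⁻ y, u x * v y * K x y ∂μ ∂μ =
      ∫⁻ z, ((fun z : α × α => u z.1 * K z.1 z.2 ^ (1/2:ℝ)) * (fun z : α × α => v z.2 * K z.1 z.2 ^ (1/2:ℝ))) z ∂(μ.prod μ) := by
    rw [lintegral_prod _ (by fun_prop)]
    refine lintegral_congr fun x => lintegral_congr fun y => ?_
    simp only [Pi.mul_apply]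
    rw [mul_mul_mul_comm, ← ENNReal.rpow_add_of_nonneg _ _ (by norm_num) (by norm_num)]
    norm_num
  rw [e0]
  refine (ENNReal.lintegral_mul_le_Lp_mul_Lq _ Real.HolderConjugate.two_two (by fun_prop) (by fun_prop)).trans ?_
  have hsq : ∀ a b : ℝ≥0∞, (a * b ^ (1/2:ℝ)) ^ (2:ℝ) = a ^ (2:ℝ) * b := by
    intro a b
    rw [ENNReal.mul_rpow_of_nonneg _ _ (by norm_num), ← ENNReal.rpow_mul]
    norm_num
  simp only [hsq]
  have e1 : ∫⁻ z : α × α, u z.1 ^ (2:ℝ) * K z.1 z.2 ∂(μ.prod μ) ≤ M * ∫⁻ x, u x ^ (2:ℝ) ∂μ := by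
    rw [lintegral_prod _ (by fun_prop), ← lintegral_const_mul _ (by fun_prop)]
    refine lintegral_mono fun x => ?_
    simp only
    rw [lintegral_const_mul _ (hK1 x), mul_comm]
    gcongr
    exact h1 x
  have e2 : ∫⁻ z : α × α, v z.2 ^ (2:ℝ) * K z.1 z.2 ∂(μ.prod μ) ≤ M * ∫⁻ x, v x ^ (2:ℝ) ∂μ := by
    rw [lintegral_prod_symm' _ (by fun_prop), ← lintegral_const_mul _ (by fun_prop)]
    refine lintegral_mono fun x => ?_
    simp only
    rw [lintegral_const_mul _ (hK2 x), mul_comm]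
    gcongr
    exact h2 x
  calc _ ≤ (M * ∫⁻ x, u x ^ (2:ℝ) ∂μ) ^ (1/2:ℝ) * (M * ∫⁻ x, v x ^ (2:ℝ) ∂μ) ^ (1/2:ℝ) := by
        gcongr
    _ = _ := by
        rw [ENNReal.mul_rpow_of_nonneg _ _ (by norm_num), ENNReal.mul_rpow_of_nonneg _ _ (by norm_num),
          mul_mul_mul_comm, ← ENNReal.rpow_add_of_nonneg _ _ (by norm_num) (by norm_num)]
        norm_num

lemma lintegral_gauss {n : ℕ} {b : ℝ} (hb : 0 < b) (y : Euc n) :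
    ∫⁻ x : Euc n, ENNReal.ofReal (Real.exp (-b * ‖x - y‖ ^ 2)) =
      ENNReal.ofReal ((Real.pi / b) ^ ((n:ℝ) / 2)) := by
  have h1 := lintegral_sub_right_eq_self (μ := (volume : Measure (Euc n)))
    (fun x : Euc n => ENNReal.ofReal (Real.exp (-b * ‖x‖ ^ 2))) y
  rw [h1, ← ofReal_integral_eq_lintegral_ofReal]
  · rw [GaussianFourier.integral_rexp_neg_mul_sq_norm hb]
    simp
  · have := (GaussianFourier.integrable_cexp_neg_mul_sq_norm_add (V := Euc n) (b := (b:ℂ)) (by simpa using hb) 0 0).norm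
    refine this.congr (Filter.Eventually.of_forall fun x => ?_)
    simp [Complex.norm_exp, ← Complex.ofReal_pow]
  · exact Filter.Eventually.of_forall fun x => (Real.exp_pos _).le

lemma norm_sub_polar {n : ℕ} (ω ω' : sphere (0 : Euc n) 1) (r ρ : ℝ) :
    ‖r • ω.val - ρ • ω'.val‖ ^ 2 = (r - ρ) ^ 2 + r * ρ * ‖ω.val - ω'.val‖ ^ 2 := by
  have h1 : ‖ω.val‖ = 1 := by simpa using ω.2
  have h2 : ‖ω'.val‖ = 1 := by simpa using ω'.2
  rw [norm_sub_sq_real, norm_sub_sq_real, inner_smul_left, inner_smul_right, norm_smul, norm_smul, h1, h2]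
  simp [mul_pow]
  ring

instance (n : ℕ) : IsFiniteMeasure (sphMeas n) := by unfold sphMeas; infer_instance

lemma gauss_sphere {n : ℕ} (hn : 2 ≤ n) : ∃ C : ℝ≥0, ∀ a : ℝ, 0 < a → ∀ ω : sphere (0 : Euc n) 1,
    ∫⁻ ω', ENNReal.ofReal (Real.exp (-a * ‖ω.val - ω'.val‖ ^ 2)) ∂(sphMeas n) ≤
      C * ENNReal.ofReal (a ^ (-(((n:ℝ) - 1) / 2))) := by
  have hn' : (2:ℝ) ≤ n := by exact_mod_cast hn
  set m : ℝ≥0 := (sphMeas n univ).toNNReal with hm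
  have hmu : sphMeas n univ = m := by rw [hm, ENNReal.coe_toNNReal (measure_ne_top _ _)]
  set k : ℝ := ((n:ℝ) - 1) / 2 with hk
  have hk0 : 0 < k := by rw [hk]; linarith
  refine ⟨m * Real.toNNReal ((2:ℝ) ^ k) + Real.toNNReal (Real.exp 1 * Real.pi ^ ((n:ℝ)/2) * 2 ^ k), ?_⟩
  intro a ha ω
  rcases le_total a 2 with h2 | h2
  · calc _ ≤ ∫⁻ ω', 1 ∂(sphMeas n) := by
          refine lintegral_mono fun ω' => ?_
          rw [← ENNReal.ofReal_one]
          apply ENNReal.ofReal_le_ofReal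
          rw [Real.exp_le_one_iff]
          nlinarith [sq_nonneg ‖ω.val - ω'.val‖]
      _ = m := by simp [hmu]
      _ ≤ (m * Real.toNNReal ((2:ℝ) ^ k) : ℝ≥0) * ENNReal.ofReal (a ^ (-k)) := by
          push_cast
          rw [mul_assoc]
          conv_lhs => rw [← mul_one (m : ℝ≥0∞)]
          gcongr
          change 1 ≤ ENNReal.ofReal _ * _
          rw [← ENNReal.ofReal_mul (by positivity), ENNReal.one_le_ofReal, Real.rpow_neg ha.le]
          rw [← div_eq_mul_inv, one_le_div (by positivity)]
          gcongr
      _ ≤ _ := by gcongr; simp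
  · set b := a / 2 with hb
    have hb1 : 1 ≤ b := by rw [hb]; linarith
    have hb0 : 0 < b := by linarith
    set δ := b ^ (-(1/2:ℝ)) with hδ
    have hδ0 : 0 < δ := by positivity
    have hδ1 : δ ≤ 1 := Real.rpow_le_one_of_one_le_of_nonpos hb1 (by norm_num)
    have hδ2 : b * δ ^ 2 = 1 := by
      rw [hδ, ← Real.rpow_natCast, ← Real.rpow_mul hb0.le]
      norm_num
      rw [Real.rpow_neg_one]; field_simp
    set J := ∫⁻ ω', ENNReal.ofReal (Real.exp (-a * ‖ω.val - ω'.val‖ ^ 2)) ∂(sphMeas n) with hJ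
    have key : ENNReal.ofReal (Real.exp (-1) * δ) * J ≤ ENNReal.ofReal ((Real.pi / b) ^ ((n:ℝ) / 2)) := by
      rw [← lintegral_gauss hb0 ω.val, lintegral_polar hn _ (by fun_prop)]
      calc _ = ∫⁻ r in Ioc 1 (1 + δ), ENNReal.ofReal (Real.exp (-1)) * J := by
            rw [setLIntegral_const, Real.volume_Ioc, ENNReal.ofReal_mul (Real.exp_pos _).le]
            ring_nf
        _ ≤ ∫⁻ r in Ioc 1 (1 + δ), ENNReal.ofReal (r ^ ((n:ℝ) - 1)) *
              ∫⁻ ω', ENNReal.ofReal (Real.exp (-b * ‖r • ω'.val - ω.val‖ ^ 2)) ∂(sphMeas n) := by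
            refine setLIntegral_mono' measurableSet_Ioc fun r hr => ?_
            have hr1 : 1 ≤ r := hr.1.le
            rw [hJ, ← lintegral_const_mul _ (by fun_prop)]
            conv_lhs => rw [← one_mul (lintegral _ _)]
            refine mul_le_mul' ?_ (lintegral_mono fun ω' => ?_)
            · rw [ENNReal.one_le_ofReal]
              exact Real.one_le_rpow hr1 (by linarith)
            · rw [← ENNReal.ofReal_mul (Real.exp_pos _).le, ← Real.exp_add]
              apply ENNReal.ofReal_le_ofReal
              rw [Real.exp_le_exp]
              have := norm_sub_polar ω' ω r 1
              rw [one_smul] at this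
              rw [this, norm_sub_rev ω.val]
              have h3 : (r - 1) ^ 2 ≤ δ ^ 2 := by
                apply pow_le_pow_left₀ (by linarith)
                linarith [hr.2]
              have h4 : a = 2 * b := by rw [hb]; ring
              rw [h4]
              have h5 : r ≤ 2 := by linarith [hr.2]
              nlinarith [mul_le_mul_of_nonneg_left h3 hb0.le, mul_nonneg (mul_nonneg hb0.le (sub_nonneg.2 h5)) (sq_nonneg ‖ω'.val - ω.val‖)]
        _ ≤ _ := by
            apply lintegral_mono_set
            intro r hr
            exact lt_trans one_pos hr.1
    have hpos : 0 < Real.exp (-1) * δ := by positivity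
    have hJle : J ≤ ENNReal.ofReal ((Real.pi / b) ^ ((n:ℝ) / 2)) / ENNReal.ofReal (Real.exp (-1) * δ) := by
      rw [ENNReal.le_div_iff_mul_le (Or.inl (by simpa using hpos)) (Or.inl ENNReal.ofReal_ne_top), mul_comm]
      exact key
    refine hJle.trans ?_
    rw [← ENNReal.ofReal_div_of_pos hpos]
    have e : (Real.pi / b) ^ ((n:ℝ) / 2) / (Real.exp (-1) * δ) =
        Real.exp 1 * Real.pi ^ ((n:ℝ)/2) * 2 ^ k * a ^ (-k) := by
      have h4 : a = 2 * b := by rw [hb]; ring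
      rw [h4, Real.mul_rpow (by norm_num) hb0.le, Real.div_rpow Real.pi_pos.le hb0.le, Real.exp_neg,
        Real.rpow_neg (by norm_num : (0:ℝ) ≤ 2), hδ, Real.rpow_neg hb0.le, Real.rpow_neg hb0.le]
      have : b ^ ((n:ℝ)/2) = b ^ k * b ^ (1/2:ℝ) := by
        rw [← Real.rpow_add hb0, hk]; congr 1; ring
      rw [this]
      field_simp
    rw [e, ENNReal.ofReal_mul (by positivity)]
    gcongr
    change ((Real.toNNReal _ : ℝ≥0) : ℝ≥0∞) ≤ _
    gcongr
    simp

/-- One-dimensional heat type kernel. -/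
def heatK (t x y : ℝ) : ℝ≥0∞ :=
  ENNReal.ofReal (t ^ (-(1/2:ℝ)) * Real.exp (-(Real.pi ^ 2 / t) * (x - y) ^ 2))

lemma heatK_symm (t x y : ℝ) : heatK t x y = heatK t y x := by
  unfold heatK; congr 3; ring

lemma heatK_measurable : Measurable (fun z : ℝ × ℝ × ℝ => heatK z.1 z.2.1 z.2.2) := by
  unfold heatK; fun_prop

lemma heatK_measurable2 (t : ℝ) : Measurable (fun z : ℝ × ℝ => heatK t z.1 z.2) := by
  unfold heatK; fun_prop

lemma heatK_le {t : ℝ} (ht : 0 < t) (x y : ℝ) : heatK t x y ≤ ENNReal.ofReal (t ^ (-(1/2:ℝ))) := by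
  unfold heatK
  apply ENNReal.ofReal_le_ofReal
  have : Real.exp (-(Real.pi ^ 2 / t) * (x - y) ^ 2) ≤ 1 := by
    rw [Real.exp_le_one_iff]
    have : 0 ≤ Real.pi ^ 2 / t * (x - y) ^ 2 := by positivity
    linarith
  have h2 : 0 ≤ t ^ (-(1/2:ℝ)) := by positivity
  nlinarith

lemma heatK_int {t : ℝ} (ht : 0 < t) (x : ℝ) :
    ∫⁻ y in Ioi (0:ℝ), heatK t x y ≤ 1 := by
  refine (setLIntegral_le_lintegral _ _).trans ?_
  simp_rw [heatK_symm t x]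
  unfold heatK
  have hc : 0 < Real.pi ^ 2 / t := by positivity
  have h1 := lintegral_sub_right_eq_self (μ := (volume : Measure ℝ))
    (fun y : ℝ => ENNReal.ofReal (t ^ (-(1/2:ℝ)) * Real.exp (-(Real.pi ^ 2 / t) * y ^ 2))) x
  rw [h1, ← ofReal_integral_eq_lintegral_ofReal]
  · rw [integral_const_mul, integral_gaussian, ENNReal.ofReal_le_one]
    have e : Real.pi / (Real.pi ^ 2 / t) = t / Real.pi := by field_simp
    rw [e, Real.sqrt_div ht.le, Real.rpow_neg ht.le, ← Real.sqrt_eq_rpow]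
    have h1 : 0 < Real.sqrt t := Real.sqrt_pos.2 ht
    have h2 : 1 ≤ Real.sqrt Real.pi := by
      rw [Real.one_le_sqrt]; linarith [Real.pi_gt_three]
    have h3 : (Real.sqrt t)⁻¹ * (Real.sqrt t / Real.sqrt Real.pi) = 1 / Real.sqrt Real.pi := by field_simp
    rw [h3, div_le_one (by positivity)]
    exact h2
  · exact (integrable_exp_neg_mul_sq hc).const_mul _
  · exact Filter.Eventually.of_forall fun y => by positivity

lemma tail_bound (s q : ℝ) (hs0 : 0 < s) (hs : s < 1/2) (hq : q * (1/2 + s) = 1) (γ : ℝ≥0∞) (hγ : γ ≠ ⊤) :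
    ∫⁻ t in Ioi (0:ℝ), ENNReal.ofReal (t ^ (s - 1)) * (ENNReal.ofReal (t ^ (-(1/(2*q)))) *
      (if ENNReal.ofReal (t ^ (-(1/(2*q)))) < γ then γ else 0)) ≤
      ENNReal.ofReal (1 / (1/(2*q) - s)) * γ ^ q := by
  have hq0 : 0 < q := by
    by_contra h
    nlinarith
  have hqs : 1/(2*q) = (1/2 + s)/2 := by field_simp; linarith
  obtain ⟨g, rfl⟩ : ∃ g : ℝ≥0, γ = g := ⟨γ.toNNReal, (ENNReal.coe_toNNReal hγ).symm⟩
  rcases eq_or_ne g 0 with rfl | hg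
  · simp
  have hg0 : 0 < (g:ℝ) := by positivity
  set T : ℝ := (g:ℝ) ^ (-(2*q)) with hT
  have hT0 : 0 < T := by positivity
  have hlt : ∀ t : ℝ, 0 < t → (ENNReal.ofReal (t ^ (-(1/(2*q)))) < (g:ℝ≥0∞)) → T < t := by
    intro t ht h
    rw [← ENNReal.ofReal_coe_nnreal, ENNReal.ofReal_lt_ofReal_iff hg0] at h
    have := Real.rpow_lt_rpow_of_neg (by positivity) h (show -(2*q) < 0 by linarith)
    rwa [← Real.rpow_mul ht.le, show -(1/(2*q)) * -(2*q) = 1 by field_simp, Real.rpow_one] at this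
  have hneg : s - 1 - 1/(2*q) < -1 := by rw [hqs]; linarith
  calc _ ≤ ∫⁻ t in Ioi (0:ℝ), (Ioi T).indicator (fun t => ENNReal.ofReal (t ^ (s - 1 - 1/(2*q))) * g) t := by
        refine setLIntegral_mono' measurableSet_Ioi fun t ht => ?_
        have ht : 0 < t := ht
        split_ifs with h
        · rw [indicator_of_mem (show t ∈ Ioi T from hlt t ht h), ← mul_assoc, ← ENNReal.ofReal_mul (by positivity),
            ← Real.rpow_add ht]
          rfl
        · simp
    _ ≤ ∫⁻ t, (Ioi T).indicator (fun t => ENNReal.ofReal (t ^ (s - 1 - 1/(2*q))) * g) t :=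
        setLIntegral_le_lintegral _ _
    _ = (∫⁻ t in Ioi T, ENNReal.ofReal (t ^ (s - 1 - 1/(2*q)))) * g := by
        rw [lintegral_indicator measurableSet_Ioi, lintegral_mul_const _ (by fun_prop)]
    _ = ENNReal.ofReal (-T ^ (s - 1 - 1/(2*q) + 1) / (s - 1 - 1/(2*q) + 1)) * g := by
        rw [← ofReal_integral_eq_lintegral_ofReal (integrableOn_Ioi_rpow_of_lt hneg hT0),
          integral_Ioi_rpow_of_lt hneg hT0]
        filter_upwards [ae_restrict_mem measurableSet_Ioi] with t ht
        have : 0 < t := hT0.trans ht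
        positivity
    _ = _ := by
        rw [← ENNReal.ofReal_coe_nnreal, ENNReal.ofReal_rpow_of_pos hg0, ← ENNReal.ofReal_mul', ← ENNReal.ofReal_mul']
        · congr 1
          rw [hT, ← Real.rpow_mul hg0.le]
          have e1 : -(2 * q) * (s - 1 - 1 / (2 * q) + 1) = q - 1 := by
            field_simp; linarith
          rw [e1]
          have e2 : (g:ℝ) ^ q = g ^ (q - 1) * g := by
            conv_rhs => rw [← Real.rpow_one (g:ℝ), ← Real.rpow_mul hg0.le, ← Real.rpow_add hg0]
            congr 1; ring
          rw [e2, show s - 1 - 1/(2*q) + 1 = -(1/(2*q) - s) by ring, neg_div_neg_eq]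
          ring
        · positivity
        · positivity

lemma head_bound (s q : ℝ) (hs0 : 0 < s) (hs : s < 1/2) (hq : q * (1/2 + s) = 1) (γ : ℝ≥0∞) (hγ : γ ≠ ⊤) :
    ∫⁻ t in Ioi (0:ℝ), ENNReal.ofReal (t ^ (s - 1)) *
      (if ENNReal.ofReal (t ^ (-(1/(2*q)))) < γ then 0 else γ) ^ (2:ℝ) ≤
      ENNReal.ofReal (1 / s) * γ ^ q := by
  have hq0 : 0 < q := by
    by_contra h
    nlinarith
  obtain ⟨g, rfl⟩ : ∃ g : ℝ≥0, γ = g := ⟨γ.toNNReal, (ENNReal.coe_toNNReal hγ).symm⟩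
  rcases eq_or_ne g 0 with rfl | hg
  · simp
  have hg0 : 0 < (g:ℝ) := by positivity
  set T : ℝ := (g:ℝ) ^ (-(2*q)) with hT
  have hT0 : 0 < T := by positivity
  have hlt : ∀ t : ℝ, 0 < t → ¬ (ENNReal.ofReal (t ^ (-(1/(2*q)))) < (g:ℝ≥0∞)) → t ≤ T := by
    intro t ht h
    rw [← ENNReal.ofReal_coe_nnreal, ENNReal.ofReal_lt_ofReal_iff hg0, not_lt] at h
    have := Real.rpow_le_rpow_of_nonpos hg0 h (show -(2*q) ≤ 0 by linarith)
    rwa [← Real.rpow_mul ht.le, show -(1/(2*q)) * -(2*q) = 1 by field_simp, Real.rpow_one] at this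
  have hneg : -1 < s - 1 := by linarith
  calc _ ≤ ∫⁻ t in Ioi (0:ℝ), (Ioc 0 T).indicator (fun t => ENNReal.ofReal (t ^ (s - 1)) * (g:ℝ≥0∞) ^ (2:ℝ)) t := by
        refine setLIntegral_mono' measurableSet_Ioi fun t ht => ?_
        have ht : 0 < t := ht
        split_ifs with h
        · simp
        · rw [indicator_of_mem (show t ∈ Ioc 0 T from ⟨ht, hlt t ht h⟩)]
    _ ≤ ∫⁻ t, (Ioc 0 T).indicator (fun t => ENNReal.ofReal (t ^ (s - 1)) * (g:ℝ≥0∞) ^ (2:ℝ)) t :=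
        setLIntegral_le_lintegral _ _
    _ = (∫⁻ t in Ioc 0 T, ENNReal.ofReal (t ^ (s - 1))) * (g:ℝ≥0∞) ^ (2:ℝ) := by
        rw [lintegral_indicator measurableSet_Ioc, lintegral_mul_const _ (by fun_prop)]
    _ = ENNReal.ofReal (T ^ s / s) * (g:ℝ≥0∞) ^ (2:ℝ) := by
        rw [← ofReal_integral_eq_lintegral_ofReal, ← intervalIntegral.integral_of_le hT0.le,
          integral_rpow (Or.inl hneg)]
        · congr 2
          rw [sub_add_cancel, Real.zero_rpow hs0.ne', sub_zero]
        · exact (intervalIntegral.intervalIntegrable_rpow' hneg).1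
        · filter_upwards [ae_restrict_mem measurableSet_Ioc] with t ht
          have : 0 < t := ht.1
          positivity
    _ = _ := by
        rw [← ENNReal.ofReal_coe_nnreal, ENNReal.ofReal_rpow_of_pos hg0, ENNReal.ofReal_rpow_of_pos hg0,
          ← ENNReal.ofReal_mul', ← ENNReal.ofReal_mul']
        · congr 1
          rw [hT, ← Real.rpow_mul hg0.le]
          have e2 : (g:ℝ) ^ q = g ^ (-(2*q)*s) * g ^ (2:ℝ) := by
            rw [← Real.rpow_add hg0]
            congr 1; linarith
          rw [e2]
          ring
        · positivity
        · positivity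

set_option maxHeartbeats 2000000 in
lemma heat_form_bound (s q : ℝ) (hs0 : 0 < s) (hs : s < 1/2) (hq : q * (1/2 + s) = 1)
    (G : ℝ → ℝ≥0∞) (hG : Measurable G) (hfin : ∀ x, G x ≠ ⊤)
    (h1 : ∫⁻ x in Ioi (0:ℝ), G x ^ q ≤ 1) {t : ℝ} (ht : 0 < t) :
    ∫⁻ x in Ioi (0:ℝ), ∫⁻ y in Ioi (0:ℝ), G x * G y * heatK t x y ≤
      3 * (ENNReal.ofReal (t ^ (-(1/(2*q)))) *
        ∫⁻ x in Ioi (0:ℝ), (if ENNReal.ofReal (t ^ (-(1/(2*q)))) < G x then G x else 0)) +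
      ∫⁻ x in Ioi (0:ℝ), (if ENNReal.ofReal (t ^ (-(1/(2*q)))) < G x then 0 else G x) ^ (2:ℝ) := by
  have hq0 : 0 < q := by
    by_contra h
    nlinarith
  have hq1 : 1 < q := by
    by_contra h
    nlinarith
  set A : ℝ := t ^ (-(1/(2*q))) with hA
  have hA0 : 0 < A := by positivity
  set a : ℝ≥0∞ := ENNReal.ofReal A with ha
  have ha0 : a ≠ 0 := by simpa [ha] using hA0
  have hat : a ≠ ⊤ := ENNReal.ofReal_ne_top
  set G1 : ℝ → ℝ≥0∞ := fun x => if a < G x then G x else 0 with hG1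
  set G2 : ℝ → ℝ≥0∞ := fun x => if a < G x then 0 else G x with hG2
  have hms : MeasurableSet {x | a < G x} := measurableSet_lt measurable_const hG
  have m1 : Measurable G1 := Measurable.ite hms hG measurable_const
  have m2 : Measurable G2 := Measurable.ite hms measurable_const hG
  have hadd : ∀ x, G x = G1 x + G2 x := by
    intro x; simp only [hG1, hG2]; split_ifs <;> simp
  have hG2a : ∀ x, G2 x ≤ a := by
    intro x; simp only [hG2]; split_ifs with h
    · simp
    · exact not_lt.1 h
  set μ : Measure ℝ := volume.restrict (Ioi (0:ℝ)) with hμ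
  have mK := heatK_measurable2 t
  have mKx : ∀ x, Measurable (fun y => heatK t x y) := fun x => mK.comp measurable_prodMk_left
  have mKy : ∀ y, Measurable (fun x => heatK t x y) := fun x => mK.comp measurable_prodMk_right
  have hKi1 : ∀ x, ∫⁻ y, heatK t x y ∂μ ≤ 1 := heatK_int ht
  have hKi2 : ∀ y, ∫⁻ x, heatK t x y ∂μ ≤ 1 := by
    intro y; simp_rw [heatK_symm t _ y]; exact heatK_int ht y
  set N := ∫⁻ x, G1 x ∂μ with hN
  -- L1 bound
  have hNle : N ≤ ENNReal.ofReal (A ^ (1 - q)) := by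
    calc N ≤ ∫⁻ x, ENNReal.ofReal (A ^ (1 - q)) * G x ^ q ∂μ := by
          refine lintegral_mono fun x => ?_
          simp only [hG1]
          split_ifs with h
          · have hx0 : G x ≠ 0 := (lt_of_le_of_lt bot_le h).ne'
            have e1 : G x ^ q = G x ^ (q - 1) * G x := by
              conv_rhs => rw [← ENNReal.rpow_one (G x), ← ENNReal.rpow_mul, ← ENNReal.rpow_add _ _ hx0 (hfin x)]
              congr 1; ring
            have e2 : ENNReal.ofReal (A ^ (1 - q)) * a ^ (q - 1) = 1 := by
              rw [ha, ENNReal.ofReal_rpow_of_pos hA0, ← ENNReal.ofReal_mul (by positivity), ← Real.rpow_add hA0]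
              norm_num
            calc G x = ENNReal.ofReal (A ^ (1 - q)) * (a ^ (q - 1) * G x) := by
                  rw [← mul_assoc, e2, one_mul]
              _ ≤ _ := by
                  rw [e1]
                  gcongr
          · simp
      _ = ENNReal.ofReal (A ^ (1 - q)) * ∫⁻ x, G x ^ q ∂μ := lintegral_const_mul _ (by fun_prop)
      _ ≤ ENNReal.ofReal (A ^ (1 - q)) * 1 := by gcongr
      _ = _ := mul_one _
  have hexp : t ^ (-(1/2:ℝ)) * A ^ (1 - q) = A := by
    rw [hA, ← Real.rpow_mul ht.le, ← Real.rpow_add ht]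
    congr 1
    field_simp
    ring
  have T1 : ∫⁻ x, ∫⁻ y, G1 x * G1 y * heatK t x y ∂μ ∂μ ≤ a * N := by
    calc _ ≤ ∫⁻ x, ∫⁻ y, G1 x * (G1 y * ENNReal.ofReal (t ^ (-(1/2:ℝ)))) ∂μ ∂μ := by
          refine lintegral_mono fun x => lintegral_mono fun y => ?_
          simp only
          rw [mul_assoc]
          gcongr
          exact heatK_le ht x y
      _ = N * (N * ENNReal.ofReal (t ^ (-(1/2:ℝ)))) := by
          have : ∀ x, ∫⁻ y, G1 x * (G1 y * ENNReal.ofReal (t ^ (-(1/2:ℝ)))) ∂μ =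
              G1 x * (N * ENNReal.ofReal (t ^ (-(1/2:ℝ)))) := by
            intro x
            rw [lintegral_const_mul _ (by fun_prop), lintegral_mul_const _ (by fun_prop)]
          simp_rw [this]
          rw [lintegral_mul_const _ (by fun_prop)]
      _ ≤ N * (ENNReal.ofReal (A ^ (1 - q)) * ENNReal.ofReal (t ^ (-(1/2:ℝ)))) := by gcongr
      _ = a * N := by
          rw [← ENNReal.ofReal_mul (by positivity), mul_comm (A ^ (1-q)), hexp, mul_comm]
  have T2 : ∫⁻ x, ∫⁻ y, G1 x * G2 y * heatK t x y ∂μ ∂μ ≤ a * N := by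
    calc _ ≤ ∫⁻ x, ∫⁻ y, (G1 x * a) * heatK t x y ∂μ ∂μ := by
          refine lintegral_mono fun x => lintegral_mono fun y => ?_
          simp only
          gcongr
          exact hG2a y
      _ ≤ ∫⁻ x, (G1 x * a) * 1 ∂μ := by
          refine lintegral_mono fun x => ?_
          simp only
          rw [lintegral_const_mul _ (mKx x)]
          gcongr
          exact hKi1 x
      _ = a * N := by
          simp only [mul_one]
          rw [lintegral_mul_const _ m1, mul_comm]
  have mm : ∀ u v : ℝ → ℝ≥0∞, Measurable u → Measurable v →
      Measurable (fun z : ℝ × ℝ => u z.1 * v z.2 * heatK t z.1 z.2) := by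
    intro u v hu hv
    exact ((hu.comp measurable_fst).mul (hv.comp measurable_snd)).mul mK
  have T3 : ∫⁻ x, ∫⁻ y, G2 x * G1 y * heatK t x y ∂μ ∂μ ≤ a * N := by
    rw [lintegral_lintegral_swap (mm G2 G1 m2 m1).aemeasurable]
    refine le_trans (le_of_eq ?_) T2
    refine lintegral_congr fun x => lintegral_congr fun y => ?_
    rw [heatK_symm, mul_comm (G2 y)]
  have T4 : ∫⁻ x, ∫⁻ y, G2 x * G2 y * heatK t x y ∂μ ∂μ ≤ ∫⁻ x, G2 x ^ (2:ℝ) ∂μ := by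
    refine (schur_test μ (heatK t) mK 1 hKi1 hKi2 G2 G2 m2 m2).trans ?_
    rw [one_mul, ← ENNReal.rpow_add_of_nonneg _ _ (by norm_num) (by norm_num)]
    norm_num
  calc _ = ∫⁻ x, ∫⁻ y, ((G1 x * G1 y * heatK t x y + G1 x * G2 y * heatK t x y) +
        (G2 x * G1 y * heatK t x y + G2 x * G2 y * heatK t x y)) ∂μ ∂μ := by
        refine lintegral_congr fun x => lintegral_congr fun y => ?_
        rw [hadd x, hadd y]; ring
    _ = (∫⁻ x, ∫⁻ y, G1 x * G1 y * heatK t x y ∂μ ∂μ + ∫⁻ x, ∫⁻ y, G1 x * G2 y * heatK t x y ∂μ ∂μ) +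
        (∫⁻ x, ∫⁻ y, G2 x * G1 y * heatK t x y ∂μ ∂μ + ∫⁻ x, ∫⁻ y, G2 x * G2 y * heatK t x y ∂μ ∂μ) := by
        have mi : ∀ u v : ℝ → ℝ≥0∞, Measurable u → Measurable v →
            Measurable (fun x => ∫⁻ y, u x * v y * heatK t x y ∂μ) := by
          intro u v hu hv
          exact (mm u v hu hv).lintegral_prod_right'
        have mx : ∀ u v : ℝ → ℝ≥0∞, Measurable u → Measurable v → ∀ x, 
            Measurable (fun y => u x * v y * heatK t x y) := by
          intro u v hu hv x
          exact (mm u v hu hv).comp measurable_prodMk_left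
        have e : ∀ x, ∫⁻ y, ((G1 x * G1 y * heatK t x y + G1 x * G2 y * heatK t x y) +
            (G2 x * G1 y * heatK t x y + G2 x * G2 y * heatK t x y)) ∂μ =
            (∫⁻ y, G1 x * G1 y * heatK t x y ∂μ + ∫⁻ y, G1 x * G2 y * heatK t x y ∂μ) +
            (∫⁻ y, G2 x * G1 y * heatK t x y ∂μ + ∫⁻ y, G2 x * G2 y * heatK t x y ∂μ) := by
          intro x
          have hh : Measurable (fun y => G1 x * G1 y * heatK t x y + G1 x * G2 y * heatK t x y) :=
            (mx G1 G1 m1 m1 x).add (mx G1 G2 m1 m2 x)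
          rw [lintegral_add_left hh,
            lintegral_add_left (mx G1 G1 m1 m1 x), lintegral_add_left (mx G2 G1 m2 m1 x)]
        simp_rw [e]
        have hh : Measurable (fun x => ∫⁻ y, G1 x * G1 y * heatK t x y ∂μ +
            ∫⁻ y, G1 x * G2 y * heatK t x y ∂μ) := (mi G1 G1 m1 m1).add (mi G1 G2 m1 m2)
        rw [lintegral_add_left hh,
            lintegral_add_left (mi G1 G1 m1 m1), lintegral_add_left (mi G2 G1 m2 m1)]
    _ ≤ (a * N + a * N) + (a * N + ∫⁻ x, G2 x ^ (2:ℝ) ∂μ) := by gcongr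
    _ = _ := by ring

lemma hls_unit (s q : ℝ) (hs0 : 0 < s) (hs : s < 1/2) (hq : q * (1/2 + s) = 1)
    (G : ℝ → ℝ≥0∞) (hG : Measurable G) (hfin : ∀ x, G x ≠ ⊤)
    (h1 : ∫⁻ x in Ioi (0:ℝ), G x ^ q ≤ 1) :
    ∫⁻ t in Ioi (0:ℝ), ENNReal.ofReal (t ^ (s - 1)) *
      ∫⁻ x in Ioi (0:ℝ), ∫⁻ y in Ioi (0:ℝ), G x * G y * heatK t x y ≤
      3 * ENNReal.ofReal (1 / (1/(2*q) - s)) + ENNReal.ofReal (1 / s) := by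
  set μ : Measure ℝ := volume.restrict (Ioi (0:ℝ)) with hμ
  have hms : MeasurableSet {z : ℝ × ℝ | ENNReal.ofReal (z.1 ^ (-(1/(2*q)))) < G z.2} :=
    measurableSet_lt (by fun_prop) (by fun_prop)
  have m1 : Measurable (fun z : ℝ × ℝ => if ENNReal.ofReal (z.1 ^ (-(1/(2*q)))) < G z.2 then G z.2 else 0) :=
    Measurable.ite hms (by fun_prop) measurable_const
  have m2 : Measurable (fun z : ℝ × ℝ => if ENNReal.ofReal (z.1 ^ (-(1/(2*q)))) < G z.2 then 0 else G z.2) :=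
    Measurable.ite hms measurable_const (by fun_prop)
  have m1x : ∀ t : ℝ, Measurable (fun x => if ENNReal.ofReal (t ^ (-(1/(2*q)))) < G x then G x else 0) :=
    fun t => m1.comp measurable_prodMk_left
  have m2x : ∀ t : ℝ, Measurable (fun x => if ENNReal.ofReal (t ^ (-(1/(2*q)))) < G x then 0 else G x) :=
    fun t => m2.comp measurable_prodMk_left
  calc _ ≤ ∫⁻ t, (3 * ∫⁻ x, ENNReal.ofReal (t ^ (s - 1)) * (ENNReal.ofReal (t ^ (-(1/(2*q)))) *
        (if ENNReal.ofReal (t ^ (-(1/(2*q)))) < G x then G x else 0)) ∂μ) +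
      ∫⁻ x, ENNReal.ofReal (t ^ (s - 1)) *
         (if ENNReal.ofReal (t ^ (-(1/(2*q)))) < G x then 0 else G x) ^ (2:ℝ) ∂μ ∂μ := by
        refine setLIntegral_mono' measurableSet_Ioi fun t ht => ?_
        refine (mul_le_mul_right (heat_form_bound s q hs0 hs hq G hG hfin h1 ht) _).trans (le_of_eq ?_)
        rw [lintegral_const_mul _ ((m1x t).const_mul _), lintegral_const_mul _ (m1x t), 
          lintegral_const_mul _ ((m2x t).pow_const _)]
        ring
    _ = 3 * (∫⁻ t, ∫⁻ x, ENNReal.ofReal (t ^ (s - 1)) * (ENNReal.ofReal (t ^ (-(1/(2*q)))) *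
        (if ENNReal.ofReal (t ^ (-(1/(2*q)))) < G x then G x else 0)) ∂μ ∂μ) +
      ∫⁻ t, ∫⁻ x, ENNReal.ofReal (t ^ (s - 1)) *
         (if ENNReal.ofReal (t ^ (-(1/(2*q)))) < G x then 0 else G x) ^ (2:ℝ) ∂μ ∂μ := by
        have mi : Measurable (fun t => ∫⁻ x, ENNReal.ofReal (t ^ (s - 1)) * (ENNReal.ofReal (t ^ (-(1/(2*q)))) *
        (if ENNReal.ofReal (t ^ (-(1/(2*q)))) < G x then G x else 0)) ∂μ) := by
          apply Measurable.lintegral_prod_right' (f := fun z : ℝ × ℝ => ENNReal.ofReal (z.1 ^ (s - 1)) * (ENNReal.ofReal (z.1 ^ (-(1/(2*q)))) *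
        (if ENNReal.ofReal (z.1 ^ (-(1/(2*q)))) < G z.2 then G z.2 else 0)))
          fun_prop
        rw [lintegral_add_left (mi.const_mul _), lintegral_const_mul _ mi]
    _ = 3 * (∫⁻ x, ∫⁻ t, ENNReal.ofReal (t ^ (s - 1)) * (ENNReal.ofReal (t ^ (-(1/(2*q)))) *
        (if ENNReal.ofReal (t ^ (-(1/(2*q)))) < G x then G x else 0)) ∂μ ∂μ) +
      ∫⁻ x, ∫⁻ t, ENNReal.ofReal (t ^ (s - 1)) *
         (if ENNReal.ofReal (t ^ (-(1/(2*q)))) < G x then 0 else G x) ^ (2:ℝ) ∂μ ∂μ := by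
        congr 1
        · congr 1
          apply lintegral_lintegral_swap
          apply Measurable.aemeasurable
          simp only [Function.uncurry_def]
          fun_prop
        · apply lintegral_lintegral_swap
          apply Measurable.aemeasurable
          simp only [Function.uncurry_def]
          fun_prop
    _ ≤ 3 * (∫⁻ x, ENNReal.ofReal (1 / (1/(2*q) - s)) * G x ^ q ∂μ) + 
        ∫⁻ x, ENNReal.ofReal (1 / s) * G x ^ q ∂μ := by
        gcongr with x x
        · exact tail_bound s q hs0 hs hq (G x) (hfin x)
        · exact head_bound s q hs0 hs hq (G x) (hfin x)
    _ ≤ 3 * (ENNReal.ofReal (1 / (1/(2*q) - s)) * 1) + ENNReal.ofReal (1 / s) * 1 := by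
        rw [lintegral_const_mul _ (by fun_prop), lintegral_const_mul _ (by fun_prop)]
        gcongr
    _ = _ := by simp

lemma hls (s q : ℝ) (hs0 : 0 < s) (hs : s < 1/2) (hq : q * (1/2 + s) = 1)
    (G : ℝ → ℝ≥0∞) (hG : Measurable G) (hfin : ∀ x, G x ≠ ⊤)
    (h0 : ∫⁻ x in Ioi (0:ℝ), G x ^ q ≠ 0) (htop : ∫⁻ x in Ioi (0:ℝ), G x ^ q ≠ ⊤) :
    ∫⁻ t in Ioi (0:ℝ), ENNReal.ofReal (t ^ (s - 1)) *
      ∫⁻ x in Ioi (0:ℝ), ∫⁻ y in Ioi (0:ℝ), G x * G y * heatK t x y ≤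
      (3 * ENNReal.ofReal (1 / (1/(2*q) - s)) + ENNReal.ofReal (1 / s)) *
        ((∫⁻ x in Ioi (0:ℝ), G x ^ q) ^ (1/q)) ^ 2 := by
  have hq0 : 0 < q := by
    by_contra h
    nlinarith
  set Q := ∫⁻ x in Ioi (0:ℝ), G x ^ q with hQ
  set c := Q ^ (1/q) with hc
  have hc0 : c ≠ 0 := by
    rw [hc]; simp [h0, htop]
  have hct : c ≠ ⊤ := by
    rw [hc]; exact ENNReal.rpow_ne_top_of_nonneg (by positivity) htop
  have hcq : c ^ q = Q := by rw [hc, ← ENNReal.rpow_mul, one_div_mul_cancel hq0.ne', ENNReal.rpow_one]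
  have hcc : c * c⁻¹ = 1 := ENNReal.mul_inv_cancel hc0 hct
  have key := hls_unit s q hs0 hs hq (fun x => c⁻¹ * G x) (by fun_prop)
    (fun x => ENNReal.mul_ne_top (ENNReal.inv_ne_top.2 hc0) (hfin x)) (by
      simp_rw [ENNReal.mul_rpow_of_nonneg _ _ hq0.le]
      rw [lintegral_const_mul _ (by fun_prop), ENNReal.inv_rpow, hcq]
      exact (ENNReal.inv_mul_cancel h0 htop).le)
  have mK : ∀ t, Measurable (fun z : ℝ × ℝ => heatK t z.1 z.2) := heatK_measurable2
  have mK3 := heatK_measurable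
  refine le_trans (le_of_eq ?_) (mul_le_mul_left key (c ^ 2))
  rw [← lintegral_mul_const']
  · refine lintegral_congr fun t => ?_
    rw [mul_assoc, ← lintegral_mul_const']
    · congr 1
      refine lintegral_congr fun x => ?_
      rw [← lintegral_mul_const']
      · refine lintegral_congr fun y => ?_
        rw [show c⁻¹ * G x * (c⁻¹ * G y) * heatK t x y * c ^ 2 = (c * c⁻¹) * (c * c⁻¹) * (G x * G y * heatK t x y) by ring,
          hcc]
        simp
      · simp [hct]
    · simp [hct]
  · simp [hct]

lemma fourier_cont {n : ℕ} (g : Euc n → ℂ) (hg : Integrable g) : Continuous (𝓕 g) :=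
  VectorFourier.fourierIntegral_continuous (L := innerₗ (Euc n)) Real.continuous_fourierChar continuous_inner hg

lemma fourier_bdd {n : ℕ} (g : Euc n → ℂ) (ξ : Euc n) : ‖𝓕 g ξ‖ ≤ ∫ v, ‖g v‖ :=
  VectorFourier.norm_fourierIntegral_le_integral_norm _ _ _ _ _

lemma fourier_flip {n : ℕ} (f g : Euc n → ℂ) (hf : Integrable f) (hg : Integrable g) :
    ∫ ξ, 𝓕 f ξ * g ξ = ∫ x, f x * 𝓕 g x := by
  simpa using! (VectorFourier.integral_fourierIntegral_smul_eq_flip (L := innerₗ (Euc n))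
      Real.continuous_fourierChar continuous_inner hf hg)

lemma integrable_gauss {n : ℕ} {b : ℝ} (hb : 0 < b) :
    Integrable (fun x : Euc n => Real.exp (-b * ‖x‖ ^ 2)) := by
  have := (GaussianFourier.integrable_cexp_neg_mul_sq_norm_add (V := Euc n) (b := (b:ℂ)) (by simpa using hb) 0 0).norm
  refine this.congr (Filter.Eventually.of_forall fun x => ?_)
  simp [Complex.norm_exp, ← Complex.ofReal_pow]

lemma conj_fourier {n : ℕ} (g : Euc n → ℂ) (ξ : Euc n) :
    (starRingEnd ℂ) (𝓕 g ξ) = 𝓕 (fun x => (starRingEnd ℂ) (g x)) (-ξ) := by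
  rw [Real.fourier_eq', Real.fourier_eq', ← integral_conj]
  congr 1
  ext v
  simp only [smul_eq_mul, map_mul, ← Complex.exp_conj, inner_neg_right]
  congr 2
  simp
  left
  exact map_ofNat _ 2

lemma gauss_energy {n : ℕ} {b : ℝ} (hb : 0 < b) (g : Euc n → ℂ) (hg : Integrable g) :
    ∫⁻ ξ, ENNReal.ofReal (Real.exp (-b * ‖ξ‖ ^ 2)) * ‖𝓕 g ξ‖ₑ ^ (2:ℝ) ≤
      ∫⁻ x, ∫⁻ y, ‖g x‖ₑ * ‖g y‖ₑ *
        ENNReal.ofReal ((Real.pi / b) ^ ((n:ℝ)/2) * Real.exp (-(Real.pi ^ 2 / b) * ‖x - y‖ ^ 2)) := by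
  have hbre : 0 < (b:ℂ).re := by simpa using hb
  set gc : Euc n → ℂ := fun x => (starRingEnd ℂ) (g x) with hgc
  have hgci : Integrable gc := by
    simpa [hgc] using! (Complex.conjLIE.toContinuousLinearEquiv.toContinuousLinearMap).integrable_comp hg
  set m : Euc n → ℂ := fun ξ => (starRingEnd ℂ) (𝓕 g ξ) * (Real.exp (-b * ‖ξ‖ ^ 2) : ℂ) with hm
  have hmi : Integrable m := by
    apply (integrable_gauss hb).ofReal.bdd_mul (c := ∫ v, ‖g v‖)
    · exact (Complex.continuous_conj.comp (fourier_cont g hg)).aestronglyMeasurable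
    · exact Filter.Eventually.of_forall fun ξ => by simpa using fourier_bdd g ξ
  have hmb : ∀ x, 𝓕 m x = ∫ y, gc y * (((Real.pi / b) ^ ((n:ℝ)/2) * Real.exp (-(Real.pi ^ 2 / b) * ‖x - y‖ ^ 2) : ℝ) : ℂ) := by
    intro x
    have hJ : Integrable (fun v : Euc n => Complex.exp (-(b:ℂ) * ‖v‖ ^ 2 + 2 * Real.pi * Complex.I * (inner ℝ x v : ℝ))) :=
      GaussianFourier.integrable_cexp_neg_mul_sq_norm_add hbre _ _
    have h1 := fourier_flip gc _ hgci hJ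
    have h2 : ∀ y, 𝓕 (fun v : Euc n => Complex.exp (-(b:ℂ) * ‖v‖ ^ 2 + 2 * Real.pi * Complex.I * (inner ℝ x v : ℝ))) y =
       (((Real.pi / b) ^ ((n:ℝ)/2) * Real.exp (-(Real.pi ^ 2 / b) * ‖x - y‖ ^ 2) : ℝ) : ℂ) := by
      intro y
      rw [fourier_gaussian_innerProductSpace' hbre]
      push_cast
      rw [Complex.ofReal_cpow (by positivity)]
      simp only [finrank_euclideanSpace, Fintype.card_fin]
      push_cast
      congr 2
      ring
    simp_rw [h2] at h1
    rw [← h1, Real.fourier_eq', ← integral_neg_eq_self]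
    congr 1
    ext ξ
    simp only [hm, hgc, smul_eq_mul]
    rw [conj_fourier, neg_neg, norm_neg, mul_left_comm, Complex.ofReal_exp, ← Complex.exp_add]
    congr 2
    rw [inner_neg_left, real_inner_comm]
    push_cast
    ring
  have h3 : ∫⁻ ξ, ENNReal.ofReal (Real.exp (-b * ‖ξ‖ ^ 2)) * ‖𝓕 g ξ‖ₑ ^ (2:ℝ) = ‖∫ ξ, 𝓕 g ξ * m ξ‖ₑ := by
    have e1 : ∀ ξ, 𝓕 g ξ * m ξ = ((Real.exp (-b * ‖ξ‖ ^ 2) * ‖𝓕 g ξ‖ ^ 2 : ℝ) : ℂ) := by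
      intro ξ
      simp only [hm]
      rw [← mul_assoc, Complex.mul_conj, Complex.normSq_eq_norm_sq]
      push_cast; ring
    have hi : Integrable (fun ξ => Real.exp (-b * ‖ξ‖ ^ 2) * ‖𝓕 g ξ‖ ^ 2) := by
      apply (integrable_gauss hb).mul_bdd (c := (∫ v, ‖g v‖) ^ 2)
      · exact ((fourier_cont g hg).norm.pow 2).aestronglyMeasurable
      · refine Filter.Eventually.of_forall fun ξ => ?_
        rw [Real.norm_of_nonneg (by positivity)]
        exact pow_le_pow_left₀ (norm_nonneg _) (fourier_bdd g ξ) 2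
    simp_rw [e1]
    rw [integral_complex_ofReal, ← ofReal_norm, Complex.norm_real, Real.norm_of_nonneg (integral_nonneg fun ξ => by positivity),
      ofReal_integral_eq_lintegral_ofReal hi (Filter.Eventually.of_forall fun ξ => by positivity)]
    refine lintegral_congr fun ξ => ?_
    rw [ENNReal.ofReal_mul (by positivity), ENNReal.ofReal_pow (norm_nonneg _), ofReal_norm]
    norm_num
  rw [h3, fourier_flip g m hg hmi]
  refine (enorm_integral_le_lintegral_enorm _).trans ?_
  refine lintegral_mono fun x => ?_
  simp only
  rw [enorm_mul, hmb]
  calc _ ≤ ‖g x‖ₑ * ∫⁻ y, ‖g y‖ₑ * ENNReal.ofReal ((Real.pi / b) ^ ((n:ℝ)/2) * Real.exp (-(Real.pi ^ 2 / b) * ‖x - y‖ ^ 2)) := by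
        gcongr
        refine (enorm_integral_le_lintegral_enorm _).trans (le_of_eq ?_)
        refine lintegral_congr fun y => ?_
        rw [enorm_mul]
        congr 1
        · simp only [hgc, ← ofReal_norm]; simp
        · rw [← ofReal_norm, Complex.norm_real, Real.norm_of_nonneg (by positivity)]
    _ = _ := by
        rw [← lintegral_const_mul' _ _ (by simp)]
        simp_rw [mul_assoc]

lemma gamma_rep {s : ℝ} (hs : 0 < s) {x : ℝ} (hx : 0 < x) :
    ENNReal.ofReal (x ^ (-(2*s))) = ENNReal.ofReal (1 / Real.Gamma s) *
      ∫⁻ b in Ioi (0:ℝ), ENNReal.ofReal (b ^ (s - 1)) * ENNReal.ofReal (Real.exp (-b * x ^ 2)) := by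
  have h := Real.integral_rpow_mul_exp_neg_mul_Ioi hs (show 0 < x ^ 2 by positivity)
  have hi : IntegrableOn (fun b : ℝ => b ^ (s - 1) * Real.exp (-(x ^ 2 * b))) (Ioi 0) := by
    by_contra hc
    rw [integral_undef hc] at h
    have : 0 < (1 / x ^ 2) ^ s * Real.Gamma s := by have := Real.Gamma_pos_of_pos hs; positivity
    linarith
  have e : ∫⁻ b in Ioi (0:ℝ), ENNReal.ofReal (b ^ (s - 1)) * ENNReal.ofReal (Real.exp (-b * x ^ 2)) =
      ENNReal.ofReal ((1 / x ^ 2) ^ s * Real.Gamma s) := by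
    rw [← h, ofReal_integral_eq_lintegral_ofReal hi]
    · refine setLIntegral_congr_fun measurableSet_Ioi fun b hb => ?_
      have hb : 0 < b := hb
      rw [← ENNReal.ofReal_mul (by positivity)]
      congr 3; ring
    · filter_upwards [ae_restrict_mem measurableSet_Ioi] with b hb
      have hb : 0 < b := hb
      positivity
  have hG := Real.Gamma_pos_of_pos hs
  rw [e, ← ENNReal.ofReal_mul (by positivity)]
  congr 1
  have : x ^ (-(2*s)) = (1/x^2) ^ s := by
    rw [Real.rpow_neg hx.le, Real.rpow_mul hx.le, one_div, Real.inv_rpow (by positivity)]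
    norm_num
  rw [this]; field_simp

/-- Radial profile `r ↦ r^{(n-1)/2} ‖g(r·)‖_{L²(S)}`. -/
def prof {n : ℕ} (g : Euc n → ℂ) (r : ℝ) : ℝ≥0∞ :=
  ENNReal.ofReal (r ^ (((n:ℝ) - 1) / 2)) * L2sph (fun ω => g (r • ω.val))

lemma L2sph_measurable {n : ℕ} (g : Euc n → ℂ) (hg : Measurable g) :
    Measurable (fun r : ℝ => L2sph (fun ω => g (r • ω.val))) := by
  unfold L2sph
  apply Measurable.pow_const
  apply Measurable.lintegral_prod_right' (f := fun z : ℝ × sphere (0 : Euc n) 1 => (‖g (z.1 • z.2.val)‖₊ : ℝ≥0∞) ^ (2:ℝ))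
  fun_prop

lemma prof_measurable {n : ℕ} (g : Euc n → ℂ) (hg : Measurable g) : Measurable (prof g) := by
  unfold prof
  have := L2sph_measurable g hg
  fun_prop

lemma sphere_step {n : ℕ} {C : ℝ≥0}
    (hC : ∀ a : ℝ, 0 < a → ∀ ω : sphere (0 : Euc n) 1,
    ∫⁻ ω', ENNReal.ofReal (Real.exp (-a * ‖ω.val - ω'.val‖ ^ 2)) ∂(sphMeas n) ≤
      C * ENNReal.ofReal (a ^ (-(((n:ℝ) - 1) / 2))))
    (g : Euc n → ℂ) (hg : Measurable g) {b r ρ : ℝ} (hb : 0 < b) (hr : 0 < r) (hρ : 0 < ρ) :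
    ENNReal.ofReal (r ^ ((n:ℝ) - 1)) * (ENNReal.ofReal (ρ ^ ((n:ℝ) - 1)) *
      ∫⁻ ω, ∫⁻ ω', ‖g (r • ω.val)‖ₑ * ‖g (ρ • ω'.val)‖ₑ *
        ENNReal.ofReal ((Real.pi / b) ^ ((n:ℝ)/2) *
          Real.exp (-(Real.pi ^ 2 / b) * ‖r • ω.val - ρ • ω'.val‖ ^ 2)) ∂(sphMeas n) ∂(sphMeas n)) ≤
      C * ENNReal.ofReal (Real.pi ^ (1 - (n:ℝ)/2)) * (prof g r * prof g ρ * heatK b r ρ) := by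
  set a : ℝ := Real.pi ^ 2 / b * (r * ρ) with ha
  have ha0 : 0 < a := by positivity
  set c : ℝ := (Real.pi / b) ^ ((n:ℝ)/2) * Real.exp (-(Real.pi ^ 2 / b) * (r - ρ) ^ 2) with hc
  have hc0 : 0 < c := by positivity
  have e1 : ∀ ω ω' : sphere (0 : Euc n) 1, ENNReal.ofReal ((Real.pi / b) ^ ((n:ℝ)/2) *
          Real.exp (-(Real.pi ^ 2 / b) * ‖r • ω.val - ρ • ω'.val‖ ^ 2)) =
      ENNReal.ofReal c * ENNReal.ofReal (Real.exp (-a * ‖ω.val - ω'.val‖ ^ 2)) := by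
    intro ω ω'
    rw [← ENNReal.ofReal_mul hc0.le, hc, mul_assoc, ← Real.exp_add, norm_sub_polar]
    congr 3
    rw [ha]; ring
  have hS := schur_test (sphMeas n) (fun ω ω' => ENNReal.ofReal (Real.exp (-a * ‖ω.val - ω'.val‖ ^ 2)))
    (by fun_prop) _ (hC a ha0) (by
      intro ω'
      simp_rw [fun ω : sphere (0 : Euc n) 1 => norm_sub_rev ω.val ω'.val]
      exact hC a ha0 ω') (fun ω => ‖g (r • ω.val)‖ₑ) (fun ω => ‖g (ρ • ω.val)‖ₑ) (by fun_prop) (by fun_prop)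
  have e2 : ∫⁻ ω, ∫⁻ ω', ‖g (r • ω.val)‖ₑ * ‖g (ρ • ω'.val)‖ₑ *
        ENNReal.ofReal ((Real.pi / b) ^ ((n:ℝ)/2) *
          Real.exp (-(Real.pi ^ 2 / b) * ‖r • ω.val - ρ • ω'.val‖ ^ 2)) ∂(sphMeas n) ∂(sphMeas n) =
      ENNReal.ofReal c * ∫⁻ ω, ∫⁻ ω', ‖g (r • ω.val)‖ₑ * ‖g (ρ • ω'.val)‖ₑ *
        ENNReal.ofReal (Real.exp (-a * ‖ω.val - ω'.val‖ ^ 2)) ∂(sphMeas n) ∂(sphMeas n) := by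
    rw [← lintegral_const_mul' _ _ ENNReal.ofReal_ne_top]
    refine lintegral_congr fun ω => ?_
    rw [← lintegral_const_mul' _ _ ENNReal.ofReal_ne_top]
    refine lintegral_congr fun ω' => ?_
    rw [e1]; ring
  rw [e2]
  have hnum : r ^ ((n:ℝ) - 1) * ρ ^ ((n:ℝ) - 1) * c * a ^ (-(((n:ℝ) - 1) / 2)) =
      Real.pi ^ (1 - (n:ℝ)/2) * r ^ (((n:ℝ) - 1)/2) * ρ ^ (((n:ℝ) - 1)/2) *
        (b ^ (-(1/2:ℝ)) * Real.exp (-(Real.pi ^ 2 / b) * (r - ρ) ^ 2)) := by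
    have k1 : ∀ x : ℝ, 0 < x → x ^ ((n:ℝ) - 1) = x ^ (((n:ℝ) - 1)/2) * x ^ (((n:ℝ) - 1)/2) := by
      intro x hx; rw [← Real.rpow_add hx]; congr 1; ring
    have k2 : a ^ (-(((n:ℝ) - 1) / 2)) = Real.pi ^ (-((n:ℝ) - 1)) * b ^ (((n:ℝ)-1)/2) * 
        (r ^ (((n:ℝ) - 1)/2))⁻¹ * (ρ ^ (((n:ℝ) - 1)/2))⁻¹ := by
      rw [ha, Real.mul_rpow (by positivity) (by positivity), Real.mul_rpow (by positivity) (by positivity),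
        Real.div_rpow (by positivity) (by positivity), Real.rpow_neg hr.le, Real.rpow_neg hρ.le, Real.rpow_neg hb.le,
        ← Real.rpow_natCast, ← Real.rpow_mul Real.pi_pos.le, div_inv_eq_mul]
      have : ((2:ℕ):ℝ) * (-(((n:ℝ) - 1) / 2)) = -((n:ℝ) - 1) := by push_cast; ring
      rw [this]; ring
    have k3 : (Real.pi / b) ^ ((n:ℝ)/2) * Real.pi ^ (-((n:ℝ) - 1)) * b ^ (((n:ℝ)-1)/2) =
        Real.pi ^ (1 - (n:ℝ)/2) * b ^ (-(1/2:ℝ)) := by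
      rw [Real.div_rpow (by positivity) hb.le, div_eq_mul_inv, ← Real.rpow_neg hb.le]
      have : (1 - (n:ℝ)/2) = (n:ℝ)/2 + (-((n:ℝ) - 1)) := by ring
      rw [this, Real.rpow_add Real.pi_pos]
      have : -(1/2:ℝ) = -((n:ℝ)/2) + ((n:ℝ)-1)/2 := by ring
      rw [this, Real.rpow_add hb]; ring
    rw [k1 r hr, k1 ρ hρ, k2, hc]
    have hr' : r ^ (((n:ℝ) - 1)/2) ≠ 0 := by positivity
    have hρ' : ρ ^ (((n:ℝ) - 1)/2) ≠ 0 := by positivity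
    set X := r ^ (((n:ℝ) - 1)/2)
    set Y := ρ ^ (((n:ℝ) - 1)/2)
    calc _ = ((Real.pi / b) ^ ((n:ℝ)/2) * Real.pi ^ (-((n:ℝ) - 1)) * b ^ (((n:ℝ)-1)/2)) * X * Y *
          (X * X⁻¹) * (Y * Y⁻¹) * Real.exp (-(Real.pi ^ 2 / b) * (r - ρ) ^ 2) := by ring
      _ = _ := by rw [k3, mul_inv_cancel₀ hr', mul_inv_cancel₀ hρ']; ring
  clear_value c a
  calc _ ≤ ENNReal.ofReal (r ^ ((n:ℝ) - 1)) * (ENNReal.ofReal (ρ ^ ((n:ℝ) - 1)) *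
      (ENNReal.ofReal c * ((C * ENNReal.ofReal (a ^ (-(((n:ℝ) - 1) / 2)))) *
        (L2sph (fun ω => g (r • ω.val)) * L2sph (fun ω => g (ρ • ω.val)))))) := by
        gcongr
        exact hS
    _ = C * (ENNReal.ofReal (r ^ ((n:ℝ) - 1) * ρ ^ ((n:ℝ) - 1) * c * a ^ (-(((n:ℝ) - 1) / 2)))) *
        (L2sph (fun ω => g (r • ω.val)) * L2sph (fun ω => g (ρ • ω.val))) := by
        rw [ENNReal.ofReal_mul (by positivity), ENNReal.ofReal_mul (by positivity), ENNReal.ofReal_mul (by positivity)]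
        ring
    _ = _ := by
        rw [hnum, ENNReal.ofReal_mul (by positivity), ENNReal.ofReal_mul (by positivity), ENNReal.ofReal_mul (by positivity)]
        unfold prof heatK
        ring

lemma polar_step {n : ℕ} (hn : 2 ≤ n) {C : ℝ≥0}
    (hC : ∀ a : ℝ, 0 < a → ∀ ω : sphere (0 : Euc n) 1,
    ∫⁻ ω', ENNReal.ofReal (Real.exp (-a * ‖ω.val - ω'.val‖ ^ 2)) ∂(sphMeas n) ≤
      C * ENNReal.ofReal (a ^ (-(((n:ℝ) - 1) / 2))))
    (g : Euc n → ℂ) (hg : Measurable g) {b : ℝ} (hb : 0 < b) :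
    ∫⁻ x, ∫⁻ y, ‖g x‖ₑ * ‖g y‖ₑ *
        ENNReal.ofReal ((Real.pi / b) ^ ((n:ℝ)/2) * Real.exp (-(Real.pi ^ 2 / b) * ‖x - y‖ ^ 2)) ≤
      C * ENNReal.ofReal (Real.pi ^ (1 - (n:ℝ)/2)) *
        ∫⁻ r in Ioi (0:ℝ), ∫⁻ ρ in Ioi (0:ℝ), prof g r * prof g ρ * heatK b r ρ := by
  set k : Euc n → Euc n → ℝ≥0∞ := fun x y => ‖g x‖ₑ * ‖g y‖ₑ *
        ENNReal.ofReal ((Real.pi / b) ^ ((n:ℝ)/2) * Real.exp (-(Real.pi ^ 2 / b) * ‖x - y‖ ^ 2)) with hk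
  have mk : Measurable (fun z : Euc n × Euc n => k z.1 z.2) := by simp only [hk]; fun_prop
  have mkx : ∀ x, Measurable (k x) := fun x => mk.comp measurable_prodMk_left
  have hCt : (C : ℝ≥0∞) * ENNReal.ofReal (Real.pi ^ (1 - (n:ℝ)/2)) ≠ ⊤ :=
    ENNReal.mul_ne_top ENNReal.coe_ne_top ENNReal.ofReal_ne_top
  change ∫⁻ x, ∫⁻ y, k x y ≤ _
  rw [lintegral_polar hn (fun x => ∫⁻ y, k x y) mk.lintegral_prod_right', ← lintegral_const_mul' _ _ hCt]
  refine setLIntegral_mono' measurableSet_Ioi fun r hr => ?_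
  have e1 : ∫⁻ ω, (∫⁻ y, k (r • ω.val) y) ∂(sphMeas n) =
      ∫⁻ ρ in Ioi (0:ℝ), ENNReal.ofReal (ρ ^ ((n:ℝ) - 1)) *
        ∫⁻ ω, ∫⁻ ω', k (r • ω.val) (ρ • ω'.val) ∂(sphMeas n) ∂(sphMeas n) := by
    simp_rw [fun x => lintegral_polar hn (k x) (mkx x)]
    have m3 : Measurable (fun z : (sphere (0 : Euc n) 1 × ℝ) × sphere (0 : Euc n) 1 => k (r • z.1.1.val) (z.1.2 • z.2.val)) := by
      exact mk.comp (f := fun z : (sphere (0 : Euc n) 1 × ℝ) × sphere (0 : Euc n) 1 => (r • z.1.1.val, z.1.2 • z.2.val)) (by fun_prop)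
    have m4 : Measurable (fun z : sphere (0 : Euc n) 1 × ℝ => ∫⁻ ω', k (r • z.1.val) (z.2 • ω'.val) ∂(sphMeas n)) :=
      m3.lintegral_prod_right'
    rw [lintegral_lintegral_swap]
    · refine lintegral_congr fun ρ => ?_
      rw [lintegral_const_mul' _ _ ENNReal.ofReal_ne_top]
    · apply Measurable.aemeasurable
      simp only [Function.uncurry_def]
      exact Measurable.mul (by fun_prop) m4
  rw [e1, ← lintegral_const_mul' _ _ ENNReal.ofReal_ne_top, ← lintegral_const_mul' _ _ hCt]
  refine setLIntegral_mono' measurableSet_Ioi fun ρ hρ => ?_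
  exact sphere_step hC g hg hb hr hρ

lemma neg_sob {n : ℕ} (hn : 2 ≤ n) {s : ℝ} (hs : 0 < s) : ∃ C : ℝ≥0, ∀ g : Euc n → ℂ, Measurable g → Integrable g →
    ∫⁻ ξ, ENNReal.ofReal (‖ξ‖ ^ (-(2*s))) * ‖𝓕 g ξ‖ₑ ^ (2:ℝ) ≤
      C * ∫⁻ b in Ioi (0:ℝ), ENNReal.ofReal (b ^ (s - 1)) *
        ∫⁻ r in Ioi (0:ℝ), ∫⁻ ρ in Ioi (0:ℝ), prof g r * prof g ρ * heatK b r ρ := by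
  obtain ⟨C, hC⟩ := gauss_sphere hn
  refine ⟨Real.toNNReal (1 / Real.Gamma s) * (C * Real.toNNReal (Real.pi ^ (1 - (n:ℝ)/2))), ?_⟩
  intro g hgm hg
  have : Nontrivial (Euc n) := by
    apply Module.nontrivial_of_finrank_pos (R := ℝ)
    simp; omega
  have mF : Measurable (𝓕 g) := (fourier_cont g hg).measurable
  have hCt : (C : ℝ≥0∞) * ENNReal.ofReal (Real.pi ^ (1 - (n:ℝ)/2)) ≠ ⊤ :=
    ENNReal.mul_ne_top ENNReal.coe_ne_top ENNReal.ofReal_ne_top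
  calc _ = ∫⁻ ξ, ENNReal.ofReal (1 / Real.Gamma s) * ∫⁻ b in Ioi (0:ℝ), ENNReal.ofReal (b ^ (s - 1)) * (ENNReal.ofReal (Real.exp (-b * ‖ξ‖ ^ 2)) * ‖𝓕 g ξ‖ₑ ^ (2:ℝ)) := by
        refine lintegral_congr_ae ?_
        have h0 : ∀ᵐ ξ : Euc n, ξ ≠ 0 := by simp [ae_iff]
        filter_upwards [h0] with ξ hξ
        rw [gamma_rep hs (norm_pos_iff.2 hξ), mul_assoc, ← lintegral_mul_const' _ _ (by simp)]
        simp_rw [mul_assoc]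
    _ = ENNReal.ofReal (1 / Real.Gamma s) * ∫⁻ b in Ioi (0:ℝ), ENNReal.ofReal (b ^ (s - 1)) * ∫⁻ ξ, (ENNReal.ofReal (Real.exp (-b * ‖ξ‖ ^ 2)) * ‖𝓕 g ξ‖ₑ ^ (2:ℝ)) := by
        rw [lintegral_const_mul' _ _ ENNReal.ofReal_ne_top, lintegral_lintegral_swap]
        · congr 1
          refine lintegral_congr fun b => ?_
          rw [lintegral_const_mul' _ _ ENNReal.ofReal_ne_top]
        · apply Measurable.aemeasurable
          simp only [Function.uncurry_def]
          fun_prop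
    _ ≤ ENNReal.ofReal (1 / Real.Gamma s) * ∫⁻ b in Ioi (0:ℝ), (C * ENNReal.ofReal (Real.pi ^ (1 - (n:ℝ)/2))) * (ENNReal.ofReal (b ^ (s - 1)) *
          ∫⁻ r in Ioi (0:ℝ), ∫⁻ ρ in Ioi (0:ℝ), prof g r * prof g ρ * heatK b r ρ) := by
        refine mul_le_mul_right (setLIntegral_mono' measurableSet_Ioi fun b hb => ?_) _
        rw [mul_left_comm]
        exact mul_le_mul_right ((gauss_energy hb g hg).trans (polar_step hn hC g hgm hb)) _
    _ = _ := by
        rw [lintegral_const_mul' _ _ hCt, ← mul_assoc]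
        push_cast
        rfl

lemma L2sph_sq {n : ℕ} (g : sphere (0 : Euc n) 1 → ℂ) :
    L2sph g ^ (2:ℝ) = ∫⁻ ω, ‖g ω‖ₑ ^ (2:ℝ) ∂(sphMeas n) := by
  unfold L2sph
  rw [← ENNReal.rpow_mul]
  norm_num
  rfl

lemma prof_sq {n : ℕ} (f : Euc n → ℂ) {r : ℝ} (hr : 0 < r) :
    prof f r ^ (2:ℝ) = ENNReal.ofReal (r ^ ((n:ℝ) - 1)) *
      ∫⁻ ω, ‖f (r • ω.val)‖ₑ ^ (2:ℝ) ∂(sphMeas n) := by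
  unfold prof
  rw [ENNReal.mul_rpow_of_nonneg _ _ (by norm_num), L2sph_sq,
    ENNReal.ofReal_rpow_of_pos (by positivity), ← Real.rpow_mul hr.le]
  congr 4
  ring

lemma radial_int {n : ℕ} (hn : 2 ≤ n) (f : Euc n → ℂ) (hf : Measurable f) (W : ℝ → ℝ≥0∞)
    (hW : Measurable W) :
    ∫⁻ x, ‖f x‖ₑ ^ (2:ℝ) * W ‖x‖ = ∫⁻ r in Ioi (0:ℝ), prof f r ^ (2:ℝ) * W r := by
  rw [lintegral_polar hn (fun x => ‖f x‖ₑ ^ (2:ℝ) * W ‖x‖) (by fun_prop)]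
  refine setLIntegral_congr_fun measurableSet_Ioi fun r hr => ?_
  have hr : 0 < r := hr
  have e : ∀ ω : sphere (0 : Euc n) 1, ‖r • ω.val‖ = r := by
    intro ω
    rw [norm_smul, Real.norm_of_nonneg hr.le, mem_sphere_zero_iff_norm.1 ω.2, mul_one]
  simp_rw [e]
  rw [lintegral_mul_const _ (by fun_prop), ← mul_assoc, prof_sq f hr]

lemma lhs_eq {n : ℕ} (f : Euc n → ℂ) (p : ℝ) (hp : 2 ≤ p) :
    ∫⁻ r in Ioi (0:ℝ), (ENNReal.ofReal (r ^ (((n:ℝ) - 1) * (1/2 - 1/p))) *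
              L2sph (fun ω => f (r • ω.val))) ^ p *
            ENNReal.ofReal (r ^ ((n:ℝ) - 1)) = ∫⁻ r in Ioi (0:ℝ), prof f r ^ p := by
  have hp0 : 0 < p := by linarith
  refine setLIntegral_congr_fun measurableSet_Ioi fun r hr => ?_
  have hr : 0 < r := hr
  unfold prof
  rw [ENNReal.mul_rpow_of_nonneg _ _ hp0.le, ENNReal.mul_rpow_of_nonneg _ _ hp0.le,
    mul_right_comm, ENNReal.ofReal_rpow_of_pos (by positivity),
    ENNReal.ofReal_rpow_of_pos (by positivity), ← ENNReal.ofReal_mul (by positivity),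
    ← Real.rpow_mul hr.le, ← Real.rpow_mul hr.le, ← Real.rpow_add hr]
  congr 3
  field_simp
  ring

lemma pairing {n : ℕ} (hn : 2 ≤ n) (s : ℝ) (f g : Euc n → ℂ) (hf : ContDiff ℝ (⊤ : ℕ∞) f)
    (hc : HasCompactSupport f) (hg : Integrable g) :
    ‖∫ x, f x * g x‖ₑ ≤ homSobNorm s f *
      (∫⁻ ξ, ENNReal.ofReal (‖ξ‖ ^ (-(2*s))) * ‖𝓕 g ξ‖ₑ ^ (2:ℝ)) ^ (1/2:ℝ) := by
  have : Nontrivial (Euc n) := by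
    apply Module.nontrivial_of_finrank_pos (R := ℝ)
    simp; omega
  set φ := hc.toSchwartzMap hf with hφ
  have hφf : (φ : Euc n → ℂ) = f := rfl
  have hfi : Integrable f := φ.integrable
  have hFi : Integrable (𝓕 f) := by
    have := (𝓕 φ).integrable (μ := volume)
    rwa [SchwartzMap.fourier_coe, hφf] at this
  have inv : ∀ x, f x = 𝓕 (fun ξ => 𝓕 f (-ξ)) x := by
    intro x
    rw [← Real.fourierInv_eq_fourier_comp_neg, hf.continuous.fourierInv_fourier_eq hfi hFi]
  have e : ∫ x, f x * g x = ∫ ξ, 𝓕 f (-ξ) * 𝓕 g ξ := by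
    rw [← fourier_flip (fun ξ => 𝓕 f (-ξ)) g hFi.comp_neg hg]
    refine integral_congr_ae (Filter.Eventually.of_forall fun x => ?_)
    simp only
    rw [← inv x]
  have mF : Measurable (𝓕 f) := (fourier_cont f hfi).measurable
  have mG : Measurable (𝓕 g) := (fourier_cont g hg).measurable
  rw [e]
  calc _ ≤ ∫⁻ ξ, ‖𝓕 f (-ξ) * 𝓕 g ξ‖ₑ := enorm_integral_le_lintegral_enorm _
    _ = ∫⁻ ξ, ((fun ξ => ENNReal.ofReal (‖ξ‖ ^ s) * ‖𝓕 f (-ξ)‖ₑ) *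
          (fun ξ => ENNReal.ofReal (‖ξ‖ ^ (-s)) * ‖𝓕 g ξ‖ₑ)) ξ := by
        refine lintegral_congr_ae ?_
        have h0 : ∀ᵐ ξ : Euc n, ξ ≠ 0 := by simp [ae_iff]
        filter_upwards [h0] with ξ hξ
        have hξ := norm_pos_iff.2 hξ
        have h1 : ENNReal.ofReal (‖ξ‖ ^ s) * ENNReal.ofReal (‖ξ‖ ^ (-s)) = 1 := by
          rw [← ENNReal.ofReal_mul (by positivity), ← Real.rpow_add hξ]; simp
        rw [Pi.mul_apply, mul_mul_mul_comm, h1, one_mul, enorm_mul]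
    _ ≤ _ := ENNReal.lintegral_mul_le_Lp_mul_Lq _ Real.HolderConjugate.two_two
        (by fun_prop) (by fun_prop)
    _ = _ := by
        congr 2
        · rw [← lintegral_neg_eq_self]
          refine lintegral_congr_ae ?_
          have h0 : ∀ᵐ ξ : Euc n, ξ ≠ 0 := by simp [ae_iff]
          filter_upwards [h0] with ξ hξ
          have hξ := norm_pos_iff.2 hξ
          rw [ENNReal.mul_rpow_of_nonneg _ _ (by norm_num), norm_neg, neg_neg,
            ENNReal.ofReal_rpow_of_pos (by positivity), ← Real.rpow_mul hξ.le, mul_comm s]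
          rfl
        · refine lintegral_congr_ae ?_
          have h0 : ∀ᵐ ξ : Euc n, ξ ≠ 0 := by simp [ae_iff]
          filter_upwards [h0] with ξ hξ
          have hξ := norm_pos_iff.2 hξ
          rw [ENNReal.mul_rpow_of_nonneg _ _ (by norm_num),
            ENNReal.ofReal_rpow_of_pos (by positivity), ← Real.rpow_mul hξ.le]
          congr 3
          ring_nf

lemma case_two {n : ℕ} (hn : 2 ≤ n) (f : Euc n → ℂ) (hf : ContDiff ℝ (⊤ : ℕ∞) f)
    (hc : HasCompactSupport f) :
    ∫⁻ r in Ioi (0:ℝ), prof f r ^ (2:ℝ) = ∫⁻ ξ, ‖𝓕 f ξ‖ₑ ^ (2:ℝ) := by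
  have h := radial_int hn f hf.continuous.measurable (fun _ => 1) measurable_const
  simp only [mul_one] at h
  rw [← h]
  set φ := hc.toSchwartzMap hf with hφ
  have hφf : (φ : Euc n → ℂ) = f := rfl
  have h2 := SchwartzMap.integral_norm_sq_fourier φ
  have key : ∀ ψ : SchwartzMap (Euc n) ℂ, ∫⁻ x, ‖ψ x‖ₑ ^ (2:ℝ) = ENNReal.ofReal (∫ x, ‖ψ x‖ ^ 2) := by
    intro ψ
    rw [ofReal_integral_eq_lintegral_ofReal]
    · refine lintegral_congr fun x => ?_
      rw [ENNReal.ofReal_pow (norm_nonneg _), ofReal_norm]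
      norm_num
    · exact (ψ.memLp 2).integrable_norm_pow (by norm_num)
    · exact Filter.Eventually.of_forall fun x => by positivity
  have k1 := key φ
  have k2 := key (𝓕 φ)
  rw [h2, ← k1, SchwartzMap.fourier_coe, hφf] at k2
  exact k2.symm

lemma prof_finite {n : ℕ} (f : Euc n → ℂ) {M : ℝ≥0∞} (hM : M ≠ ⊤) (h : ∀ x, ‖f x‖ₑ ≤ M) (r : ℝ) :
    prof f r ≤ ENNReal.ofReal (r ^ (((n:ℝ) - 1) / 2)) * (M ^ (2:ℝ) * sphMeas n univ) ^ (1/2:ℝ) := by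
  unfold prof L2sph
  gcongr
  calc _ ≤ ∫⁻ ω, M ^ (2:ℝ) ∂(sphMeas n) := by
        refine lintegral_mono fun ω => ?_
        exact ENNReal.rpow_le_rpow (h _) (by norm_num)
    _ = _ := by rw [lintegral_const]

lemma prof_bound {n : ℕ} (hn : 2 ≤ n) (f : Euc n → ℂ) (hf : Continuous f) (hc : HasCompactSupport f) :
    ∃ R : ℝ, ∃ B : ℝ≥0∞, 0 < R ∧ B ≠ ⊤ ∧ (∀ r, prof f r ≠ ⊤) ∧ (∀ r, 0 ≤ r → prof f r ≤ B) ∧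
      ∀ r, R < r → prof f r = 0 := by
  obtain ⟨M, hM⟩ := hc.exists_bound_of_continuous hf
  obtain ⟨R, hR0, hR⟩ := hc.isCompact.isBounded.exists_pos_norm_le
  have hMe : ∀ x, ‖f x‖ₑ ≤ ENNReal.ofReal M := by
    intro x; rw [← ofReal_norm]; exact ENNReal.ofReal_le_ofReal (hM x)
  have hfin := prof_finite f ENNReal.ofReal_ne_top hMe
  have hct : (ENNReal.ofReal M ^ (2:ℝ) * sphMeas n univ) ^ (1/2:ℝ) ≠ ⊤ := by
    apply ENNReal.rpow_ne_top_of_nonneg (by norm_num)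
    exact ENNReal.mul_ne_top (ENNReal.rpow_ne_top_of_nonneg (by norm_num) ENNReal.ofReal_ne_top)
      (measure_ne_top _ _)
  have hz : ∀ r, R < r → prof f r = 0 := by
    intro r hr
    have : ∀ ω : sphere (0 : Euc n) 1, f (r • ω.val) = 0 := by
      intro ω
      by_contra h
      have := hR _ (subset_tsupport f h)
      rw [norm_smul, Real.norm_of_nonneg (by linarith), mem_sphere_zero_iff_norm.1 ω.2, mul_one] at this
      linarith
    unfold prof L2sph
    simp [this]
  have hn' : (2:ℝ) ≤ n := by exact_mod_cast hn
  refine ⟨R, ENNReal.ofReal (R ^ (((n:ℝ) - 1) / 2)) * (ENNReal.ofReal M ^ (2:ℝ) * sphMeas n univ) ^ (1/2:ℝ),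
    hR0, ENNReal.mul_ne_top ENNReal.ofReal_ne_top hct, ?_, ?_, hz⟩
  · intro r
    exact ne_top_of_le_ne_top (ENNReal.mul_ne_top ENNReal.ofReal_ne_top hct) (hfin r)
  · intro r hr
    rcases le_or_gt r R with h | h
    · refine (hfin r).trans ?_
      gcongr
      linarith
    · rw [hz r h]; exact bot_le

lemma prof_mul {n : ℕ} (f g : Euc n → ℂ) (w : ℝ → ℝ≥0∞) (hw : ∀ r, w r ≠ ⊤)
    (h : ∀ x, ‖g x‖ₑ = ‖f x‖ₑ * w ‖x‖) {r : ℝ} (hr : 0 < r) : prof g r = prof f r * w r := by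
  have e : ∀ ω : sphere (0 : Euc n) 1, ‖r • ω.val‖ = r := by
    intro ω
    rw [norm_smul, Real.norm_of_nonneg hr.le, mem_sphere_zero_iff_norm.1 ω.2, mul_one]
  have e2 : L2sph (fun ω => g (r • ω.val)) = L2sph (fun ω => f (r • ω.val)) * w r := by
    have : L2sph (fun ω => g (r • ω.val)) ^ (2:ℝ) = (L2sph (fun ω => f (r • ω.val)) * w r) ^ (2:ℝ) := by
      rw [ENNReal.mul_rpow_of_nonneg _ _ (by norm_num), L2sph_sq, L2sph_sq,
        ← lintegral_mul_const' _ _ (ENNReal.rpow_ne_top_of_nonneg (by norm_num) (hw r))]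
      refine lintegral_congr fun ω => ?_
      rw [h, e, ENNReal.mul_rpow_of_nonneg _ _ (by norm_num)]
    exact ENNReal.rpow_left_injective (by norm_num) this
  unfold prof
  rw [e2, mul_assoc]

lemma case_gt {n : ℕ} (hn : 2 ≤ n) {p : ℝ} (hp : 2 < p) : ∃ C : ℝ≥0, ∀ f : Euc n → ℂ,
    ContDiff ℝ (⊤ : ℕ∞) f → HasCompactSupport f →
    (∫⁻ r in Ioi (0:ℝ), prof f r ^ p) ^ (1/p) ≤ C * homSobNorm (1/2 - 1/p) f := by
  have hp0 : 0 < p := by linarith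
  have hpi : 1/p < 1/2 := one_div_lt_one_div_of_lt (by norm_num) hp
  have hpi0 : 0 < 1/p := by positivity
  set s : ℝ := 1/2 - 1/p with hs
  have hs0 : 0 < s := by linarith
  have hs2 : s < 1/2 := by linarith
  set q : ℝ := p / (p - 1) with hq
  have hp1 : 0 < p - 1 := by linarith
  have hqs : q * (1/2 + s) = 1 := by
    rw [hq, hs]; field_simp; ring
  have hq0 : 0 < q := by positivity
  have hq1 : 1/p + 1/q = 1 := by
    rw [hq]; field_simp; ring
  obtain ⟨C, hC⟩ := neg_sob hn hs0
  set D : ℝ≥0∞ := (C * (3 * ENNReal.ofReal (1 / (1/(2*q) - s)) + ENNReal.ofReal (1 / s))) ^ (1/2:ℝ) with hD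
  have hDt : D ≠ ⊤ := by
    apply ENNReal.rpow_ne_top_of_nonneg (by norm_num)
    finiteness
  refine ⟨D.toNNReal, fun f hf hc => ?_⟩
  rw [ENNReal.coe_toNNReal hDt]
  obtain ⟨R, B, hR, hB, hF, hFB, hFz⟩ := prof_bound hn f hf.continuous hc
  have mf : Measurable f := hf.continuous.measurable
  set F := prof f with hFdef
  have mF : Measurable F := prof_measurable f mf
  set I := ∫⁻ r in Ioi (0:ℝ), F r ^ p with hI
  have hIt : I ≠ ⊤ := by
    refine ne_top_of_le_ne_top (b := ∫⁻ r in Ioc (0:ℝ) R, B ^ p) ?_ ?_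
    · rw [setLIntegral_const]
      refine ENNReal.mul_ne_top (ENNReal.rpow_ne_top_of_nonneg hp0.le hB) (by simp)
    · rw [hI, ← lintegral_indicator measurableSet_Ioi, ← lintegral_indicator measurableSet_Ioc]
      refine lintegral_mono fun r => ?_
      simp only [indicator, mem_Ioi, mem_Ioc]
      split_ifs with h1 h2 h2
      · exact ENNReal.rpow_le_rpow (hFB r h1.le) hp0.le
      · rw [hFz r (by by_contra h; exact h2 ⟨h1, not_lt.1 h⟩), ENNReal.zero_rpow_of_pos hp0]
      · exact bot_le
      · exact le_rfl
  by_cases hI0 : I = 0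
  · rw [hI0, ENNReal.zero_rpow_of_pos hpi0]; exact bot_le
  -- dual function
  have hwt : ∀ r, F r ^ (p - 2) ≠ ⊤ := fun r => ENNReal.rpow_ne_top_of_nonneg (by linarith) (hF r)
  set W : ℝ → ℝ := fun r => (F r ^ (p - 2)).toReal with hW
  have mW : Measurable W := by fun_prop
  have hWe : ∀ r, ENNReal.ofReal (W r) = F r ^ (p - 2) := fun r => ENNReal.ofReal_toReal (hwt r)
  have hW0 : ∀ r, 0 ≤ W r := fun r => ENNReal.toReal_nonneg
  set g : Euc n → ℂ := fun x => (starRingEnd ℂ) (f x) * (W ‖x‖ : ℂ) with hg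
  have mg : Measurable g := by
    simp only [hg]
    exact (Complex.continuous_conj.measurable.comp mf).mul
      (Complex.measurable_ofReal.comp (mW.comp measurable_norm))
  have hfi : Integrable f := hf.continuous.integrable_of_hasCompactSupport hc
  have gi : Integrable g := by
    have h1 : Integrable (fun x => (starRingEnd ℂ) (f x)) := by
      refine hfi.mono (Complex.continuous_conj.measurable.comp mf).aestronglyMeasurable ?_
      exact Filter.Eventually.of_forall fun x => by simp
    refine h1.mul_bdd (c := (B ^ (p-2)).toReal)
      (Complex.measurable_ofReal.comp (mW.comp measurable_norm)).aestronglyMeasurable ?_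
    refine Filter.Eventually.of_forall fun x => ?_
    rw [Complex.norm_real, Real.norm_of_nonneg (hW0 _)]
    exact ENNReal.toReal_mono (ENNReal.rpow_ne_top_of_nonneg (by linarith) hB)
      (ENNReal.rpow_le_rpow (hFB _ (norm_nonneg _)) (by linarith))
  have hge : ∀ x, ‖g x‖ₑ = ‖f x‖ₑ * (F ‖x‖ ^ (p - 2)) := by
    intro x
    rw [← hWe, hg, enorm_mul, ← ofReal_norm ((W ‖x‖ : ℝ) : ℂ), Complex.norm_real,
      Real.norm_of_nonneg (hW0 _), ← ofReal_norm, ← ofReal_norm (f x)]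
    simp
  have hpg : ∀ r, 0 < r → prof g r = F r ^ (p - 1) := by
    intro r hr
    rw [prof_mul f g (fun r => F r ^ (p - 2)) hwt hge hr]
    change F r * F r ^ (p - 2) = _
    nth_rewrite 1 [← ENNReal.rpow_one (F r)]
    rw [← ENNReal.rpow_add_of_nonneg _ _ (by norm_num) (by linarith)]
    congr 1; ring
  -- the pairing equals I
  have hpair : I = ‖∫ x, f x * g x‖ₑ := by
    have e1 : I = ∫⁻ x, ‖f x‖ₑ ^ (2:ℝ) * F ‖x‖ ^ (p - 2) := by
      rw [radial_int hn f mf (fun r => F r ^ (p - 2)) (by fun_prop)]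
      refine lintegral_congr fun r => ?_
      rw [← hFdef, ← ENNReal.rpow_add_of_nonneg _ _ (by norm_num) (by linarith)]
      congr 1; ring
    have e2 : ∀ x, f x * g x = ((‖f x‖ ^ 2 * W ‖x‖ : ℝ) : ℂ) := by
      intro x
      simp only [hg]
      rw [← mul_assoc, Complex.mul_conj, Complex.normSq_eq_norm_sq]
      push_cast; ring
    have e3 : ∀ x, ‖f x‖ₑ ^ (2:ℝ) * F ‖x‖ ^ (p - 2) = ENNReal.ofReal (‖f x‖ ^ 2 * W ‖x‖) := by
      intro x
      rw [ENNReal.ofReal_mul (by positivity), hWe, ENNReal.ofReal_pow (norm_nonneg _), ofReal_norm]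
      norm_num
    have hnn : ∀ x, 0 ≤ ‖f x‖ ^ 2 * W ‖x‖ := fun x => mul_nonneg (by positivity) (hW0 _)
    have mm : Measurable (fun x : Euc n => ‖f x‖ ^ 2 * W ‖x‖) :=
      (mf.norm.pow_const 2).mul (mW.comp measurable_norm)
    have hi : Integrable (fun x : Euc n => ‖f x‖ ^ 2 * W ‖x‖) := by
      refine ⟨mm.aestronglyMeasurable, ?_⟩
      rw [hasFiniteIntegral_iff_ofReal (Filter.Eventually.of_forall hnn)]
      simp_rw [← e3]
      rw [← e1]
      exact lt_top_iff_ne_top.2 hIt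
    simp_rw [e2]
    rw [integral_complex_ofReal, ← ofReal_norm, Complex.norm_real,
      Real.norm_of_nonneg (integral_nonneg hnn),
      ofReal_integral_eq_lintegral_ofReal hi (Filter.Eventually.of_forall hnn), e1]
    exact lintegral_congr e3
  -- HLS
  have hGq : ∫⁻ r in Ioi (0:ℝ), (F r ^ (p - 1)) ^ q = I := by
    refine lintegral_congr fun r => ?_
    rw [← ENNReal.rpow_mul]
    congr 1; rw [hq]; field_simp
  have hls' := hls s q hs0 hs2 hqs (fun r => F r ^ (p - 1)) (by fun_prop)
    (fun r => ENNReal.rpow_ne_top_of_nonneg hp1.le (hF r)) (by rw [hGq]; exact hI0)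
    (by rw [hGq]; exact hIt)
  rw [hGq] at hls'
  have hneg := hC g mg gi
  have e4 : ∫⁻ b in Ioi (0:ℝ), ENNReal.ofReal (b ^ (s - 1)) *
        ∫⁻ r in Ioi (0:ℝ), ∫⁻ ρ in Ioi (0:ℝ), prof g r * prof g ρ * heatK b r ρ =
      ∫⁻ b in Ioi (0:ℝ), ENNReal.ofReal (b ^ (s - 1)) *
        ∫⁻ r in Ioi (0:ℝ), ∫⁻ ρ in Ioi (0:ℝ), F r ^ (p - 1) * F ρ ^ (p - 1) * heatK b r ρ := by
    refine lintegral_congr fun b => ?_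
    congr 1
    refine setLIntegral_congr_fun measurableSet_Ioi fun r hr => ?_
    refine setLIntegral_congr_fun measurableSet_Ioi fun ρ hρ => ?_
    rw [hpg r hr, hpg ρ hρ]
  rw [e4] at hneg
  have hfinal : I ≤ homSobNorm s f * (D * I ^ (1/q)) := by
    calc I = ‖∫ x, f x * g x‖ₑ := hpair
      _ ≤ _ := pairing hn s f g hf hc gi
      _ ≤ homSobNorm s f * ((C * (3 * ENNReal.ofReal (1 / (1/(2*q) - s)) + ENNReal.ofReal (1 / s))) *
            (I ^ (1/q)) ^ (2:ℝ)) ^ (1/2:ℝ) := by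
          gcongr
          refine hneg.trans ?_
          rw [mul_assoc]
          gcongr
          refine hls'.trans (le_of_eq ?_)
          norm_num
      _ = _ := by
          rw [ENNReal.mul_rpow_of_nonneg _ _ (by norm_num : (0:ℝ) ≤ 1/2), ← ENNReal.rpow_mul _ 2 (1/2)]
          norm_num [hD]
  have hX0 : I ^ (1/q) ≠ 0 := by simp [hI0, hIt]
  have hXt : I ^ (1/q) ≠ ⊤ := ENNReal.rpow_ne_top_of_nonneg (by positivity) hIt
  have hsplit : I = I ^ (1/p) * I ^ (1/q) := by
    rw [← ENNReal.rpow_add _ _ hI0 hIt, hq1, ENNReal.rpow_one]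
  have h5 : I ^ (1/p) * I ^ (1/q) ≤ (D * homSobNorm s f) * I ^ (1/q) := by
    rw [← hsplit]
    refine hfinal.trans (le_of_eq (by ring))
  exact (ENNReal.mul_le_mul_iff_left hX0 hXt).1 h5

/-- For `n ≥ 2` and `2 ≤ p < ∞`:
`‖ r^{(n-1)(1/2-1/p)} f ‖_{L^p_r L^2_ω} ≲ ‖f‖_{Ḣ^{1/2-1/p}}` for `f ∈ C_0^∞(ℝⁿ)`,
where the `L^p_r` norm is with respect to `r^{n-1} dr` on `(0,∞)`. -/
theorem trace_estimate_LpL2 (n : ℕ) (hn : 2 ≤ n) (p : ℝ) (hp : 2 ≤ p) :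
    ∃ C : ℝ≥0, ∀ f : Euc n → ℂ, ContDiff ℝ (⊤ : ℕ∞) f → HasCompactSupport f →
      (∫⁻ r in Ioi (0:ℝ),
          (ENNReal.ofReal (r ^ (((n:ℝ) - 1) * (1/2 - 1/p))) *
              L2sph (fun ω => f (r • ω.val))) ^ p *
            ENNReal.ofReal (r ^ ((n:ℝ) - 1))) ^ (1/p) ≤
        (C : ℝ≥0∞) * homSobNorm (1/2 - 1/p) f := by
  rcases hp.eq_or_lt with h | h
  · subst h
    refine ⟨1, fun f hf hc => ?_⟩
    rw [lhs_eq f 2 le_rfl, case_two hn f hf hc]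
    unfold homSobNorm
    simp [enorm]
  · obtain ⟨C, hC⟩ := case_gt hn h
    refine ⟨C, fun f hf hc => ?_⟩
    rw [lhs_eq f p hp]
    exact hC f hf hc
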